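/- Let G = G_1 ⊔ G_2 be the disjoint union of two graphs, and fix r ≥ 1. If there exist integers ρ_1, ρ_2 such that reg(S/I(G_i)^{(s)}) ≤ 2s + ρ_i − 2 for all 1 ≤ s ≤ r and i = 1,2, then reg(S/I(G)^{(s)}) ≤ 2s + ρ_1 + ρ_2 − 2 for all 1 ≤ s ≤ r. -/

import Mathlib

open MvPolynomial

noncomputable section

namespace EdgeIdealReg

open scoped Classical

/-- The edge ideal of a simple graph, in the polynomial ring with variables the vertices. -/
def edgeIdeal (K : Type) [Field K] {V : Type} (G : SimpleGraph V) :
    Ideal (MvPolynomial V K) :=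
  Ideal.span { p | ∃ u v : V, G.Adj u v ∧ p = X u * X v }

/-- The edge ideal of the induced subgraph on a set `s` of vertices, viewed inside the
polynomial ring of the ambient graph (extra variables do not change the regularity). -/
def edgeIdealOn (K : Type) [Field K] {V : Type} (G : SimpleGraph V) (s : Set V) :
    Ideal (MvPolynomial V K) :=
  Ideal.span { p | ∃ u v : V, G.Adj u v ∧ u ∈ s ∧ v ∈ s ∧ p = X u * X v }

/-- The `r`-th symbolic power of an ideal: the intersection over all minimal primes `p` of `I`
of the contraction of `I^r` localized at `p`; concretely,
`f ∈ I^{(r)}` iff for every minimal prime `p` of `I` there is `s ∉ p` with `s * f ∈ I ^ r`. -/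
def symbolicPower {R : Type} [CommRing R] (I : Ideal R) (r : ℕ) : Ideal R where
  carrier := { f | ∀ p ∈ I.minimalPrimes, ∃ s, s ∉ p ∧ s * f ∈ I ^ r }
  zero_mem' := by
    intro p hp
    exact ⟨1, (Ideal.ne_top_iff_one p).mp hp.1.1.ne_top, by simp⟩
  add_mem' := by
    intro a b ha hb p hp
    obtain ⟨s, hs, hsa⟩ := ha p hp
    obtain ⟨t, ht, htb⟩ := hb p hp
    refine ⟨s * t, fun h => ?_, ?_⟩
    · rcases hp.1.1.mem_or_mem h with h' | h'
      · exact hs h'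
      · exact ht h'
    · have : s * t * (a + b) = t * (s * a) + s * (t * b) := by ring
      rw [this]
      exact Ideal.add_mem _ (Ideal.mul_mem_left _ _ hsa) (Ideal.mul_mem_left _ _ htb)
  smul_mem' := by
    intro c f hf p hp
    obtain ⟨s, hs, hsf⟩ := hf p hp
    refine ⟨s, hs, ?_⟩
    have : s * (c • f) = c * (s * f) := by
      simp only [smul_eq_mul]; ring
    rw [this]
    exact Ideal.mul_mem_left _ _ hsf

/-- Symbolic power with an integer exponent, with the convention `I^{(k)} = S` for `k ≤ 0`. -/
def symbolicPowerZ {R : Type} [CommRing R] (I : Ideal R) (k : ℤ) : Ideal R :=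
  if k ≤ 0 then ⊤ else symbolicPower I k.toNat

/-- A graded free resolution of `S/I` over the polynomial ring `S = K[x_v]`:
`⋯ → F_{i+1} → F_i → ⋯ → F_0 = S → S/I → 0`, where `F_i` is a graded free module with
basis elements of degrees `deg i k`, the differentials are given by matrices of homogeneous
polynomials of the appropriate degrees, the image of `F_1 → F_0 = S` is `I`, and the
complex is exact in positive homological degrees. -/
structure GradedFreeResolution {K : Type} [Field K] {σ : Type}
    (I : Ideal (MvPolynomial σ K)) where
  rank : ℕ → ℕ
  deg : (i : ℕ) → Fin (rank i) → ℕ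
  rank_zero : rank 0 = 1
  deg_zero : ∀ k, deg 0 k = 0
  mat : (i : ℕ) → Matrix (Fin (rank i)) (Fin (rank (i + 1))) (MvPolynomial σ K)
  homog : ∀ i k j, mat i k j = 0 ∨
    ∃ e, deg (i + 1) j = deg i k + e ∧ (mat i k j).IsHomogeneous e
  range_zero : ∀ f : MvPolynomial σ K,
    f ∈ I ↔ (fun _ => f) ∈ LinearMap.range (Matrix.mulVecLin (mat 0))
  isExact : ∀ i, LinearMap.ker (Matrix.mulVecLin (mat i)) =
    LinearMap.range (Matrix.mulVecLin (mat (i + 1)))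

/-- The Castelnuovo–Mumford regularity of the quotient `S/I` for a homogeneous ideal `I` of
the polynomial ring: the least `d` such that some graded free resolution of `S/I` has all its
`i`-th syzygies generated in degrees `≤ d + i` (the minimal free resolution realizes the
infimum).  By convention `reg (S/S) = ⊥ = -∞`. -/

def regQuot {K : Type} [Field K] {σ : Type} (I : Ideal (MvPolynomial σ K)) : WithBot ℤ :=
  if I = ⊤ then ⊥
  else ((sInf { d : ℤ | ∃ F : GradedFreeResolution I,
      ∀ i (k : Fin (F.rank i)), (F.deg i k : ℤ) ≤ d + i } : ℤ) : WithBot ℤ)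

/-- A set of edges of `G` that forms a matching: pairwise disjoint edges. -/
def IsMatchingSet {V : Type} (G : SimpleGraph V) (M : Finset (Sym2 V)) : Prop :=
  (M : Set (Sym2 V)) ⊆ G.edgeSet ∧
    (M : Set (Sym2 V)).Pairwise fun e f => ∀ v, v ∈ e → v ∉ f

/-- An induced matching: a matching such that no two of its edges are joined by an edge
of `G`, i.e. it is the edge set of an induced subgraph. -/
def IsInducedMatchingSet {V : Type} (G : SimpleGraph V) (M : Finset (Sym2 V)) : Prop :=
  IsMatchingSet G M ∧
    (M : Set (Sym2 V)).Pairwise fun e f => ∀ u v, u ∈ e → v ∈ f → ¬G.Adj u v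

/-- The matching number `mat(G)`. -/
def matchingNumber {V : Type} (G : SimpleGraph V) : ℕ :=
  sSup { n | ∃ M, IsMatchingSet G M ∧ M.card = n }

/-- The induced matching number `ν(G)`. -/
def inducedMatchingNumber {V : Type} (G : SimpleGraph V) : ℕ :=
  sSup { n | ∃ M, IsInducedMatchingSet G M ∧ M.card = n }

/-- `G` has an induced cycle of length `n`. -/
def HasInducedCycle {V : Type} (G : SimpleGraph V) (n : ℕ) : Prop :=
  ∃ f : ZMod n → V, Function.Injective f ∧
    ∀ i j : ZMod n, G.Adj (f i) (f j) ↔ (j = i + 1 ∨ i = j + 1)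

/-- A graph is chordal if every induced cycle has length `3`. -/
def Chordal {V : Type} (G : SimpleGraph V) : Prop :=
  ∀ n, 4 ≤ n → ¬HasInducedCycle G n

/-- A graph is weakly chordal if every induced cycle in `G` and in `Gᶜ` has length at most 4. -/
def WeaklyChordal {V : Type} (G : SimpleGraph V) : Prop :=
  (∀ n, 5 ≤ n → ¬HasInducedCycle G n) ∧ ∀ n, 5 ≤ n → ¬HasInducedCycle Gᶜ n

/-- The co-chordal cover number `cochord(G)`: the least `n` such that `n` co-chordal
subgraphs of `G` cover all the edges of `G`. -/
def cochordNumber {V : Type} (G : SimpleGraph V) : ℕ :=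
  sInf { n | ∃ H : Fin n → SimpleGraph V,
    (∀ i, H i ≤ G ∧ Chordal (H i)ᶜ) ∧ ∀ e ∈ G.edgeSet, ∃ i, e ∈ (H i).edgeSet }

/-- A graph is unicyclic if it contains exactly one cycle. -/
def Unicyclic {V : Type} (G : SimpleGraph V) : Prop :=
  ∃ (v : V) (c : G.Walk v v), c.IsCycle ∧
    ∀ (w : V) (c' : G.Walk w w), c'.IsCycle → { e | e ∈ c'.edges } = { e | e ∈ c.edges }

/-- Data exhibiting `G` as the graph `H_T` obtained from the induced subgraph on `Hset`
by attaching, at each vertex of `T ⊆ Hset`, a union of complete graphs having that vertex as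
their only common vertex: a family of cliques `C i` of `G`, each meeting `Hset` exactly in
its attachment vertex `a i ∈ T`, two distinct cliques meeting in at most the common
attachment vertex, together covering all vertices outside `Hset`, and all edges of `G`
lying either inside `Hset` or inside one of the cliques. -/
structure CliqueAttachment {V : Type} (G : SimpleGraph V) (Hset T : Set V) where
  ι : Type
  C : ι → Finset V
  a : ι → V
  a_mem_T : ∀ i, a i ∈ T
  T_sub : T ⊆ Hset
  inter_H : ∀ i, (C i : Set V) ∩ Hset = {a i}
  a_mem_C : ∀ i, a i ∈ C i
  clique : ∀ i, G.IsClique (C i)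
  pairwise_inter : ∀ i j, i ≠ j → (C i : Set V) ∩ (C j : Set V) ⊆ ({a i} : Set V)
  cover : Hset ∪ (⋃ i, (C i : Set V)) = Set.univ
  edges_sub : ∀ u v, G.Adj u v → (u ∈ Hset ∧ v ∈ Hset) ∨ ∃ i, u ∈ C i ∧ v ∈ C i

end EdgeIdealReg

namespace EdgeIdealReg
open scoped Classical

section core
variable {K : Type} [Field K] {σ : Type}

/-- The degree `j` part of the polynomial ring, `j` an integer. -/
def SG (K : Type) [Field K] (σ : Type) (j : ℤ) : AddSubgroup (MvPolynomial σ K) where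
  carrier := { f | ∀ a ∈ f.support, (a.degree : ℤ) = j }
  zero_mem' := by simp
  add_mem' := by
    intro f g hf hg a ha
    rcases Finset.mem_union.1 (MvPolynomial.support_add ha) with h | h
    · exact hf a h
    · exact hg a h
  neg_mem' := by
    intro f hf a ha
    exact hf a (by simpa using ha)

theorem mem_SG {j : ℤ} {f : MvPolynomial σ K} :
    f ∈ SG K σ j ↔ ∀ a, coeff a f ≠ 0 → (a.degree : ℤ) = j := by
  change (∀ a ∈ f.support, (a.degree : ℤ) = j) ↔ _
  simp [MvPolynomial.mem_support_iff]

theorem SG_mul {i j : ℤ} {f g : MvPolynomial σ K} (hf : f ∈ SG K σ i) (hg : g ∈ SG K σ j) :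
    f * g ∈ SG K σ (i + j) := by
  rw [mem_SG] at *
  intro a ha
  rw [coeff_mul] at ha
  obtain ⟨⟨b, c⟩, hbc, hne⟩ := Finset.exists_ne_zero_of_sum_ne_zero ha
  rw [Finset.HasAntidiagonal.mem_antidiagonal] at hbc
  have h1 := hf b (left_ne_zero_of_mul hne)
  have h2 := hg c (right_ne_zero_of_mul hne)
  simp only at hbc
  rw [← hbc, map_add]
  push_cast
  rw [h1, h2]

theorem SG_one : (1 : MvPolynomial σ K) ∈ SG K σ 0 := by
  rw [mem_SG]
  intro a ha
  rw [coeff_one] at ha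
  have : 0 = a := by by_contra h; simp [h] at ha
  simp [← this]

/-- Projection to the degree `j` part. -/
def pr (j : ℤ) (f : MvPolynomial σ K) : MvPolynomial σ K :=
  ∑ a ∈ f.support.filter (fun a => (a.degree : ℤ) = j), monomial a (coeff a f)

theorem coeff_pr (j : ℤ) (f : MvPolynomial σ K) (a : σ →₀ ℕ) :
    coeff a (pr j f) = if (a.degree : ℤ) = j then coeff a f else 0 := by
  unfold pr
  rw [coeff_sum]
  simp only [coeff_monomial]
  rw [Finset.sum_ite_eq']
  simp only [Finset.mem_filter, mem_support_iff]
  split_ifs <;> simp_all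

theorem pr_mem (j : ℤ) (f : MvPolynomial σ K) : pr j f ∈ SG K σ j := by
  rw [mem_SG]
  intro a ha
  rw [coeff_pr] at ha
  by_contra h
  simp [h] at ha

theorem pr_of_mem {j : ℤ} {f : MvPolynomial σ K} (hf : f ∈ SG K σ j) : pr j f = f := by
  ext a
  rw [coeff_pr]
  split_ifs with h
  · rfl
  · by_contra h'
    exact h (mem_SG.1 hf a (Ne.symm h'))

theorem pr_sum {ι : Type} (s : Finset ι) (j : ℤ) (f : ι → MvPolynomial σ K) :
    pr j (∑ i ∈ s, f i) = ∑ i ∈ s, pr j (f i) := by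
  ext a
  rw [coeff_pr, coeff_sum, coeff_sum]
  simp only [coeff_pr]
  split_ifs <;> simp

theorem pr_mul {i : ℤ} (j : ℤ) {g : MvPolynomial σ K} (hg : g ∈ SG K σ i)
    (f : MvPolynomial σ K) : pr j (g * f) = g * pr (j - i) f := by
  ext a
  have key : ∀ x ∈ Finset.HasAntidiagonal.antidiagonal a,
      coeff x.1 g * coeff x.2 (pr (j - i) f) =
        if (a.degree : ℤ) = j then coeff x.1 g * coeff x.2 f else 0 := by
    intro x hx
    rw [Finset.HasAntidiagonal.mem_antidiagonal] at hx
    by_cases h0 : coeff x.1 g = 0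
    · simp [h0]
    have h1 := mem_SG.1 hg _ h0
    have h2 : (a.degree : ℤ) = x.1.degree + x.2.degree := by
      rw [← hx, map_add]; push_cast; rfl
    rw [coeff_pr]
    by_cases h3 : (a.degree : ℤ) = j
    · rw [if_pos h3, if_pos (by omega)]
    · rw [if_neg h3, if_neg (by omega), mul_zero]
  rw [coeff_pr, coeff_mul, coeff_mul, Finset.sum_congr rfl key]
  split_ifs <;> simp

/-- The degree `j` part of a graded free module. -/
def FG {ι : Type} (deg : ι → ℕ) (j : ℤ) : AddSubgroup (ι → MvPolynomial σ K) where
  carrier := { x | ∀ k, x k ∈ SG K σ (j - deg k) }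
  zero_mem' := fun _ => zero_mem _
  add_mem' := fun hf hg k => add_mem (hf k) (hg k)
  neg_mem' := fun hf k => neg_mem (hf k)

theorem mem_FG {ι : Type} {deg : ι → ℕ} {j : ℤ} {x : ι → MvPolynomial σ K} :
    x ∈ FG deg j ↔ ∀ k, x k ∈ SG K σ (j - deg k) := Iff.rfl

/-- Induced grading on a submodule. -/
def subG {M : Type} [AddCommGroup M] [Module (MvPolynomial σ K) M] (N : Submodule (MvPolynomial σ K) M)
    (𝓜 : ℤ → AddSubgroup M) (j : ℤ) : AddSubgroup N :=
  (𝓜 j).comap N.subtype.toAddMonoidHom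

theorem mem_subG {M : Type} [AddCommGroup M] [Module (MvPolynomial σ K) M]
    {N : Submodule (MvPolynomial σ K) M}
    {𝓜 : ℤ → AddSubgroup M} {j : ℤ} {x : N} : x ∈ subG N 𝓜 j ↔ (x : M) ∈ 𝓜 j := Iff.rfl

/-- Compatibility of a grading with multiplication. -/
def GS {M : Type} [AddCommGroup M] [Module (MvPolynomial σ K) M] (𝓜 : ℤ → AddSubgroup M) : Prop :=
  ∀ (i j : ℤ) (s : MvPolynomial σ K) (m : M), s ∈ SG K σ i → m ∈ 𝓜 j → s • m ∈ 𝓜 (i + j)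

theorem GS_SG : GS (K := K) (σ := σ) (SG K σ) := fun _ _ _ _ h1 h2 => SG_mul h1 h2

theorem GS_FG {ι : Type} (deg : ι → ℕ) : GS (K := K) (σ := σ) (FG (K := K) (σ := σ) deg) := by
  intro i j s m h1 h2 k
  have := SG_mul h1 (h2 k)
  rw [← add_sub_assoc] at this
  exact this

theorem GS_subG {M : Type} [AddCommGroup M] [Module (MvPolynomial σ K) M]
    (N : Submodule (MvPolynomial σ K) M) {𝓜 : ℤ → AddSubgroup M} (h : GS (K := K) (σ := σ) 𝓜) :
    GS (K := K) (σ := σ) (subG N 𝓜) := fun i j s m h1 h2 => h i j s m h1 h2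

/-- A graded presentation: surjection from a graded free module. -/
structure Pres {M : Type} [AddCommGroup M] [Module (MvPolynomial σ K) M] (𝓜 : ℤ → AddSubgroup M)
    {ι : Type} (deg : ι → ℕ) (φ : (ι → MvPolynomial σ K) →ₗ[MvPolynomial σ K] M) : Prop where
  surj : Function.Surjective φ
  gr : ∀ j x, x ∈ FG deg j → φ x ∈ 𝓜 j
  grsurj : ∀ j m, m ∈ 𝓜 j → ∃ x, x ∈ FG deg j ∧ φ x = m

/-- `M` has the first `n` steps of a graded free resolution, with `i`-th generators in degrees
at most `d + i`. -/
def Q : ℕ → (M : Type) → [AddCommGroup M] → [Module (MvPolynomial σ K) M] →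
    (ℤ → AddSubgroup M) → ℤ → Prop
  | 0, _, _, _, _, _ => True
  | n + 1, _, _, _, 𝓜, d => ∃ (ι : Type) (_ : Fintype ι) (deg : ι → ℕ)
      (φ : (ι → MvPolynomial σ K) →ₗ[MvPolynomial σ K] _),
      (∀ k, (deg k : ℤ) ≤ d) ∧ Pres 𝓜 deg φ ∧
      Q n (LinearMap.ker φ) (subG (LinearMap.ker φ) (FG deg)) (d + 1)

/-- Graded short exact sequences. -/
structure SES {A B C : Type} [AddCommGroup A] [AddCommGroup B] [AddCommGroup C]
    [Module (MvPolynomial σ K) A] [Module (MvPolynomial σ K) B] [Module (MvPolynomial σ K) C]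
    (𝓐 : ℤ → AddSubgroup A) (𝓑 : ℤ → AddSubgroup B) (𝓒 : ℤ → AddSubgroup C)
    (f : A →ₗ[MvPolynomial σ K] B) (g : B →ₗ[MvPolynomial σ K] C) : Prop where
  inj : Function.Injective f
  surj : Function.Surjective g
  comp : ∀ a, g (f a) = 0
  exact : ∀ b, g b = 0 → ∃ a, f a = b
  fgr : ∀ j a, f a ∈ 𝓑 j ↔ a ∈ 𝓐 j
  ggr : ∀ j b, b ∈ 𝓑 j → g b ∈ 𝓒 j
  glift : ∀ j c, c ∈ 𝓒 j → ∃ b, b ∈ 𝓑 j ∧ g b = c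

end core
end EdgeIdealReg

namespace EdgeIdealReg
open scoped Classical

section core2
variable {K : Type} [Field K] {σ : Type}

local notation "𝕊" => MvPolynomial σ K

theorem single_mem_FG {ι : Type} (deg : ι → ℕ) (k : ι) :
    (Pi.single k 1 : ι → 𝕊) ∈ FG (K := K) (σ := σ) deg (deg k) := by
  intro k'
  by_cases h : k' = k
  · subst h
    simpa using SG_one
  · simp [h]

theorem lin_eq_sum {ι M : Type} [Fintype ι] [AddCommGroup M] [Module 𝕊 M]
    (φ : (ι → 𝕊) →ₗ[𝕊] M) (x : ι → 𝕊) : φ x = ∑ k, x k • φ (Pi.single k 1) := by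
  rw [LinearMap.pi_apply_eq_sum_univ φ x]
  refine Finset.sum_congr rfl fun k _ => ?_
  congr 2
  ext j
  simp [Pi.single_apply, eq_comm]

theorem Q_mono (n : ℕ) : ∀ {M : Type} [AddCommGroup M] [Module 𝕊 M] {𝓜 : ℤ → AddSubgroup M}
    {d d' : ℤ}, d ≤ d' → Q (K := K) (σ := σ) n M 𝓜 d → Q (K := K) (σ := σ) n M 𝓜 d' := by
  induction n with
  | zero => intros; trivial
  | succ n ih =>
    rintro M _ _ 𝓜 d d' h ⟨ι, hι, deg, φ, h1, h2, h3⟩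
    exact ⟨ι, hι, deg, φ, fun k => (h1 k).trans h, h2, ih (by omega) h3⟩

theorem Q_pred (n : ℕ) : ∀ {M : Type} [AddCommGroup M] [Module 𝕊 M] {𝓜 : ℤ → AddSubgroup M}
    {d : ℤ}, Q (K := K) (σ := σ) (n + 1) M 𝓜 d → Q (K := K) (σ := σ) n M 𝓜 d := by
  induction n with
  | zero => intros; trivial
  | succ n ih =>
    rintro M _ _ 𝓜 d ⟨ι, hι, deg, φ, h1, h2, h3⟩
    exact ⟨ι, hι, deg, φ, h1, h2, ih h3⟩

theorem Q_iso (n : ℕ) {M N : Type} [AddCommGroup M] [Module 𝕊 M] {𝓜 : ℤ → AddSubgroup M}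
    [AddCommGroup N] [Module 𝕊 N] {𝓝 : ℤ → AddSubgroup N} {d : ℤ} (e : M ≃ₗ[𝕊] N)
    (he : ∀ j m, e m ∈ 𝓝 j ↔ m ∈ 𝓜 j)
    (h : Q (K := K) (σ := σ) n M 𝓜 d) : Q (K := K) (σ := σ) n N 𝓝 d := by
  cases n with
  | zero => trivial
  | succ n =>
    obtain ⟨ι, hι, deg, φ, h1, h2, h3⟩ := h
    refine ⟨ι, hι, deg, e.toLinearMap ∘ₗ φ, h1, ⟨?_, ?_, ?_⟩, ?_⟩
    · exact e.surjective.comp h2.surj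
    · intro j x hx
      exact (he j _).2 (h2.gr j x hx)
    · intro j m hm
      obtain ⟨x, hx, hxm⟩ := h2.grsurj j (e.symm m) ((he j _).1 (by simpa using hm))
      exact ⟨x, hx, by simp [hxm]⟩
    · rw [LinearEquiv.ker_comp]
      exact h3

theorem Q_subsingleton (n : ℕ) : ∀ {M : Type} [AddCommGroup M] [Module 𝕊 M]
    {𝓜 : ℤ → AddSubgroup M} {d : ℤ} [Subsingleton M], Q (K := K) (σ := σ) n M 𝓜 d := by
  induction n with
  | zero => intros; trivial
  | succ n ih =>
    intro M _ _ 𝓜 d _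
    refine ⟨Empty, inferInstance, fun _ => 0, 0, fun k => k.elim, ⟨?_, ?_, ?_⟩, ih⟩
    · exact fun m => ⟨0, Subsingleton.elim _ _⟩
    · intro j x _
      simp
    · exact fun j m _ => ⟨0, zero_mem _, Subsingleton.elim _ _⟩

theorem Q_free (n : ℕ) {ι : Type} [Fintype ι] (deg : ι → ℕ) {d : ℤ} (h : ∀ k, (deg k : ℤ) ≤ d) :
    Q (K := K) (σ := σ) n (ι → 𝕊) (FG deg) d := by
  cases n with
  | zero => trivial
  | succ n =>
    refine ⟨ι, inferInstance, deg, LinearMap.id, h, ⟨Function.surjective_id, fun _ _ h => h,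
      fun j m hm => ⟨m, hm, rfl⟩⟩, ?_⟩
    have : Subsingleton (LinearMap.ker (LinearMap.id : (ι → 𝕊) →ₗ[𝕊] (ι → 𝕊))) := by
      rw [LinearMap.ker_id]; infer_instance
    exact Q_subsingleton n

/-- Extension by zero. -/
def inlF (α β : Type) : (α → 𝕊) →ₗ[𝕊] (α ⊕ β → 𝕊) where
  toFun x := Sum.elim x 0
  map_add' x y := by ext (i | i) <;> simp
  map_smul' s x := by ext (i | i) <;> simp

/-- Horseshoe lemma. -/
theorem Q_ext (n : ℕ) : ∀ {A B C : Type} [AddCommGroup A] [AddCommGroup B] [AddCommGroup C]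
    [Module 𝕊 A] [Module 𝕊 B] [Module 𝕊 C]
    {𝓐 : ℤ → AddSubgroup A} {𝓑 : ℤ → AddSubgroup B} {𝓒 : ℤ → AddSubgroup C}
    {f : A →ₗ[𝕊] B} {g : B →ₗ[𝕊] C} {d : ℤ}, SES (K := K) (σ := σ) 𝓐 𝓑 𝓒 f g →
    GS (K := K) (σ := σ) 𝓑 →
    Q (K := K) (σ := σ) n A 𝓐 d → Q (K := K) (σ := σ) n C 𝓒 d →
    Q (K := K) (σ := σ) n B 𝓑 d := by
  induction n with
  | zero => intros; trivial
  | succ n ih =>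
    rintro A B C _ _ _ _ _ _ 𝓐 𝓑 𝓒 f g d hs hB ⟨ι, hι, deg, φ, h1, h2, h3⟩
      ⟨κ, hκ, deg', φ', h1', h2', h3'⟩
    have hl : ∀ k, ∃ b, b ∈ 𝓑 (deg' k) ∧ g b = φ' (Pi.single k 1) := fun k =>
      hs.glift _ _ (h2'.gr _ _ (single_mem_FG deg' k))
    choose b hb hgb using hl
    let lam : (κ → 𝕊) →ₗ[𝕊] B := Fintype.linearCombination 𝕊 b
    have hlam : ∀ y, lam y = ∑ k, y k • b k := fun y => rfl
    have hglam : ∀ y, g (lam y) = φ' y := by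
      intro y
      rw [hlam, map_sum, lin_eq_sum φ' y]
      simp [hgb]
    have hlamgr : ∀ j y, y ∈ FG deg' j → lam y ∈ 𝓑 j := by
      intro j y hy
      rw [hlam]
      refine sum_mem fun k _ => ?_
      have := hB _ _ _ _ (hy k) (hb k)
      simpa using this
    let ψ : (ι ⊕ κ → 𝕊) →ₗ[𝕊] B :=
      f ∘ₗ φ ∘ₗ LinearMap.funLeft 𝕊 𝕊 Sum.inl + lam ∘ₗ LinearMap.funLeft 𝕊 𝕊 Sum.inr
    have hψ : ∀ x, ψ x = f (φ (x ∘ Sum.inl)) + lam (x ∘ Sum.inr) := fun x => rfl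
    have hgψ : ∀ x, g (ψ x) = φ' (x ∘ Sum.inr) := by
      intro x
      rw [hψ, map_add, hs.comp, zero_add, hglam]
    refine ⟨ι ⊕ κ, inferInstance, Sum.elim deg deg', ψ, ?_, ⟨?_, ?_, ?_⟩, ?_⟩
    · rintro (k | k)
      · exact h1 k
      · exact h1' k
    · intro m
      obtain ⟨y, hy⟩ := h2'.surj (g m)
      obtain ⟨a, ha⟩ := hs.exact (m - lam y) (by rw [map_sub, hglam, hy, sub_self])
      obtain ⟨x, hx⟩ := h2.surj a
      refine ⟨Sum.elim x y, ?_⟩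
      rw [hψ, Sum.elim_comp_inl, Sum.elim_comp_inr, hx, ha]
      abel
    · intro j x hx
      rw [hψ]
      refine add_mem ((hs.fgr _ _).2 (h2.gr _ _ fun k => hx (Sum.inl k)))
        (hlamgr _ _ fun k => hx (Sum.inr k))
    · intro j m hm
      obtain ⟨y, hy, hym⟩ := h2'.grsurj j (g m) (hs.ggr _ _ hm)
      obtain ⟨a, ha⟩ := hs.exact (m - lam y) (by rw [map_sub, hglam, hym, sub_self])
      obtain ⟨x, hx, hxa⟩ := h2.grsurj j a
        ((hs.fgr _ _).1 (by rw [ha]; exact sub_mem hm (hlamgr _ _ hy)))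
      refine ⟨Sum.elim x y, ?_, ?_⟩
      · rintro (k | k)
        · exact hx k
        · exact hy k
      rw [hψ, Sum.elim_comp_inl, Sum.elim_comp_inr, hxa, ha]
      abel
    · have hF : ∀ x ∈ LinearMap.ker φ, inlF ι κ x ∈ LinearMap.ker ψ := by
        intro x hx
        rw [LinearMap.mem_ker] at *
        change f (φ x) + lam 0 = 0
        rw [hx]; simp
      have hG : ∀ x ∈ LinearMap.ker ψ, LinearMap.funLeft 𝕊 𝕊 Sum.inr x ∈ LinearMap.ker φ' := by
        intro x hx
        rw [LinearMap.mem_ker] at *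
        change φ' (x ∘ Sum.inr) = 0
        rw [← hgψ, hx, map_zero]
      refine ih (f := (inlF ι κ).restrict hF)
        (g := (LinearMap.funLeft 𝕊 𝕊 Sum.inr).restrict hG) ⟨?_, ?_, ?_, ?_, ?_, ?_, ?_⟩
        (GS_subG _ (GS_FG _)) h3 h3'
      · intro x y hxy
        ext1
        have := congrArg (fun z : LinearMap.ker ψ => (z : ι ⊕ κ → 𝕊) ∘ Sum.inl) hxy
        exact this
      · rintro ⟨y, hy⟩
        rw [LinearMap.mem_ker] at hy
        obtain ⟨a, ha⟩ := hs.exact (lam y) (by rw [hglam, hy])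
        obtain ⟨x, hx⟩ := h2.surj (-a)
        refine ⟨⟨Sum.elim x y, ?_⟩, rfl⟩
        rw [LinearMap.mem_ker, hψ, Sum.elim_comp_inl, Sum.elim_comp_inr, hx, map_neg, ha]
        simp
      · rintro ⟨x, hx⟩
        rfl
      · rintro ⟨x, hx⟩ hx0
        have hx0 : x ∘ Sum.inr = 0 := congrArg Subtype.val hx0
        rw [LinearMap.mem_ker, hψ, hx0, map_zero, add_zero] at hx
        refine ⟨⟨x ∘ Sum.inl, ?_⟩, ?_⟩
        · rw [LinearMap.mem_ker]
          exact hs.inj (by rw [hx, map_zero])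
        · ext1
          change Sum.elim (x ∘ Sum.inl) 0 = x
          rw [← hx0, Sum.elim_comp_inl_inr]
      · rintro j ⟨x, hx⟩
        constructor
        · exact fun h k => h (Sum.inl k)
        · rintro h (k | k)
          · exact h k
          · exact zero_mem _
      · rintro j ⟨x, hx⟩ h k
        exact h (Sum.inr k)
      · rintro j ⟨y, hy⟩ hyj
        have hyj : y ∈ FG deg' j := hyj
        rw [LinearMap.mem_ker] at hy
        obtain ⟨a, ha⟩ := hs.exact (lam y) (by rw [hglam, hy])
        obtain ⟨x, hx, hxa⟩ := h2.grsurj j (-a)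
          (neg_mem ((hs.fgr _ _).1 (by rw [ha]; exact hlamgr _ _ hyj)))
        refine ⟨⟨Sum.elim x y, ?_⟩, ?_, rfl⟩
        · rw [LinearMap.mem_ker, hψ, Sum.elim_comp_inl, Sum.elim_comp_inr, hxa, map_neg, ha]
          simp
        · rintro (k | k)
          · exact hx k
          · exact hyj k

/-- Mapping cone lemma. -/
theorem Q_cone (n : ℕ) {A B C : Type} [AddCommGroup A] [AddCommGroup B] [AddCommGroup C]
    [Module 𝕊 A] [Module 𝕊 B] [Module 𝕊 C]
    {𝓐 : ℤ → AddSubgroup A} {𝓑 : ℤ → AddSubgroup B} {𝓒 : ℤ → AddSubgroup C}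
    {f : A →ₗ[𝕊] B} {g : B →ₗ[𝕊] C} {d : ℤ} (hs : SES (K := K) (σ := σ) 𝓐 𝓑 𝓒 f g)
    (hA : Q (K := K) (σ := σ) n A 𝓐 (d + 1)) (hB : Q (K := K) (σ := σ) (n + 1) B 𝓑 d) :
    Q (K := K) (σ := σ) (n + 1) C 𝓒 d := by
  obtain ⟨ι, hι, deg, φ, h1, h2, h3⟩ := hB
  refine ⟨ι, hι, deg, g ∘ₗ φ, h1, ⟨hs.surj.comp h2.surj, ?_, ?_⟩, ?_⟩
  · exact fun j x hx => hs.ggr _ _ (h2.gr _ _ hx)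
  · intro j c hc
    obtain ⟨b, hb, rfl⟩ := hs.glift _ _ hc
    obtain ⟨x, hx, rfl⟩ := h2.grsurj _ _ hb
    exact ⟨x, hx, rfl⟩
  · have hle : LinearMap.ker φ ≤ LinearMap.ker (g ∘ₗ φ) := LinearMap.ker_le_ker_comp _ _
    have hmem : ∀ x : LinearMap.ker (g ∘ₗ φ), φ x ∈ LinearMap.range f := by
      rintro ⟨x, hx⟩
      exact hs.exact _ hx
    let e := LinearEquiv.ofInjective f hs.inj
    have he : ∀ y : LinearMap.range f, f (e.symm y) = y := by
      intro y
      have := e.apply_symm_apply y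
      exact congrArg Subtype.val this
    let q : LinearMap.ker (g ∘ₗ φ) →ₗ[𝕊] A := e.symm.toLinearMap ∘ₗ
      LinearMap.codRestrict (LinearMap.range f) (φ ∘ₗ (LinearMap.ker (g ∘ₗ φ)).subtype) hmem
    have hq : ∀ x, f (q x) = φ x := fun x => he _
    refine Q_ext n (f := Submodule.inclusion hle) (g := q) ⟨?_, ?_, ?_, ?_, ?_, ?_, ?_⟩
      (GS_subG _ (GS_FG _)) h3 hA
    · exact Submodule.inclusion_injective hle
    · intro a
      obtain ⟨x, hx⟩ := h2.surj (f a)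
      refine ⟨⟨x, ?_⟩, hs.inj ?_⟩
      · rw [LinearMap.mem_ker, LinearMap.comp_apply, hx, hs.comp]
      · rw [hq, hx]
    · rintro ⟨x, hx⟩
      apply hs.inj
      rw [hq, map_zero]
      exact hx
    · rintro ⟨x, hx⟩ h
      refine ⟨⟨x, ?_⟩, rfl⟩
      have := hq ⟨x, hx⟩
      rw [h, map_zero] at this
      exact this.symm
    · exact fun j a => Iff.rfl
    · intro j x hx
      rw [← hs.fgr, hq]
      exact h2.gr _ _ hx
    · intro j a ha
      obtain ⟨x, hx, hxa⟩ := h2.grsurj j (f a) ((hs.fgr _ _).2 ha)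
      refine ⟨⟨x, ?_⟩, hx, hs.inj ?_⟩
      · rw [LinearMap.mem_ker, LinearMap.comp_apply, hxa, hs.comp]
      · rw [hq, hxa]

end core2
end EdgeIdealReg

namespace EdgeIdealReg
open scoped Classical

section core3
variable {K : Type} [Field K] {σ : Type}

local notation "𝕊" => MvPolynomial σ K

/-- Grading on a binary product. -/
def prodG {A B : Type} [AddCommGroup A] [AddCommGroup B]
    (𝓐 : ℤ → AddSubgroup A) (𝓑 : ℤ → AddSubgroup B) (j : ℤ) : AddSubgroup (A × B) :=
  (𝓐 j).prod (𝓑 j)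

theorem GS_prodG {A B : Type} [AddCommGroup A] [AddCommGroup B] [Module 𝕊 A] [Module 𝕊 B]
    {𝓐 : ℤ → AddSubgroup A} {𝓑 : ℤ → AddSubgroup B} (hA : GS (K := K) (σ := σ) 𝓐)
    (hB : GS (K := K) (σ := σ) 𝓑) : GS (K := K) (σ := σ) (prodG 𝓐 𝓑) :=
  fun i j s m h1 h2 => ⟨hA i j s m.1 h1 h2.1, hB i j s m.2 h1 h2.2⟩

theorem Q_prod (n : ℕ) {A B : Type} [AddCommGroup A] [AddCommGroup B] [Module 𝕊 A] [Module 𝕊 B]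
    {𝓐 : ℤ → AddSubgroup A} {𝓑 : ℤ → AddSubgroup B} (hA : GS (K := K) (σ := σ) 𝓐)
    (hB : GS (K := K) (σ := σ) 𝓑) {d : ℤ} (h1 : Q (K := K) (σ := σ) n A 𝓐 d)
    (h2 : Q (K := K) (σ := σ) n B 𝓑 d) : Q (K := K) (σ := σ) n (A × B) (prodG 𝓐 𝓑) d := by
  refine Q_ext n (f := LinearMap.inl 𝕊 A B) (g := LinearMap.snd 𝕊 A B) ⟨?_, ?_, ?_, ?_, ?_, ?_, ?_⟩
      (GS_prodG hA hB) h1 h2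
  · exact LinearMap.inl_injective
  · exact LinearMap.snd_surjective
  · intro a; rfl
  · rintro ⟨a, b⟩ h
    exact ⟨a, Prod.ext rfl h.symm⟩
  · intro j a
    exact ⟨fun h => h.1, fun h => ⟨h, zero_mem _⟩⟩
  · intro j b h
    exact h.2
  · intro j c hc
    exact ⟨(0, c), ⟨zero_mem _, hc⟩, rfl⟩

/-- Grading on a finite direct sum of shifts. -/
def piG {M ι : Type} [AddCommGroup M] (deg : ι → ℕ) (𝓜 : ℤ → AddSubgroup M) (j : ℤ) :
    AddSubgroup (ι → M) where
  carrier := { x | ∀ k, x k ∈ 𝓜 (j - deg k) }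
  zero_mem' := fun _ => zero_mem _
  add_mem' := fun hf hg k => add_mem (hf k) (hg k)
  neg_mem' := fun hf k => neg_mem (hf k)

theorem Q_pi (n : ℕ) {ι : Type} [Fintype ι] {deg : ι → ℕ} {d : ℤ} (hd : ∀ k, (deg k : ℤ) ≤ d) :
    ∀ {M : Type} [AddCommGroup M] [Module 𝕊 M]
    {𝓜 : ℤ → AddSubgroup M} {e : ℤ}, Q (K := K) (σ := σ) n M 𝓜 e →
    Q (K := K) (σ := σ) n (ι → M) (piG deg 𝓜) (d + e) := by
  induction n with
  | zero => intros; trivial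
  | succ n ih =>
    rintro M _ _ 𝓜 e ⟨κ, hκ, deg', φ, h1, h2, h3⟩
    let ψ : (ι × κ → 𝕊) →ₗ[𝕊] (ι → M) :=
      LinearMap.pi fun i => φ ∘ₗ LinearMap.funLeft 𝕊 𝕊 (fun k => (i, k))
    have hψ : ∀ x i, ψ x i = φ (fun k => x (i, k)) := fun x i => rfl
    refine ⟨ι × κ, inferInstance, fun p => deg p.1 + deg' p.2, ψ, ?_, ⟨?_, ?_, ?_⟩, ?_⟩
    · rintro ⟨i, k⟩
      have := hd i
      have := h1 k
      push_cast
      omega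
    · intro m
      choose x hx using fun i => h2.surj (m i)
      exact ⟨fun p => x p.1 p.2, funext fun i => hx i⟩
    · intro j x hx i
      rw [hψ]
      refine h2.gr _ _ fun k => ?_
      have := hx (i, k)
      push_cast at this
      rw [← sub_sub] at this
      exact this
    · intro j m hm
      choose x hx hxm using fun i => h2.grsurj _ (m i) (hm i)
      refine ⟨fun p => x p.1 p.2, ?_, funext fun i => hxm i⟩
      rintro ⟨i, k⟩
      have := hx i k
      rw [sub_sub] at this
      push_cast
      exact this
    · have := ih (M := LinearMap.ker φ) h3
      rw [← add_assoc] at this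
      have hm : ∀ y : ι → LinearMap.ker φ,
          (fun p : ι × κ => (y p.1 : κ → 𝕊) p.2) ∈ LinearMap.ker ψ := by
        intro y
        rw [LinearMap.mem_ker]
        ext i
        exact (y i).2
      let e0 : (ι → LinearMap.ker φ) →ₗ[𝕊] LinearMap.ker ψ :=
        { toFun := fun y => ⟨fun p => (y p.1 : κ → 𝕊) p.2, hm y⟩
          map_add' := fun x y => rfl
          map_smul' := fun s x => rfl }
      have hb : Function.Bijective e0 := by
        constructor
        · intro x y hxy
          funext i
          ext1
          funext k
          exact congrFun (congrArg Subtype.val hxy) (i, k)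
        · rintro ⟨x, hx⟩
          exact ⟨fun i => ⟨fun k => x (i, k), congrFun hx i⟩, rfl⟩
      refine Q_iso n (LinearEquiv.ofBijective e0 hb) ?_ this
      intro j y
      constructor
      · intro h i k
        have := h (i, k)
        push_cast at this
        rw [← sub_sub] at this
        exact this
      · rintro h ⟨i, k⟩
        have := h i k
        rw [sub_sub] at this
        push_cast
        exact this

/-- If `M` has arbitrarily long bounded partial resolutions, so does the kernel of any
bounded presentation. -/
theorem Q_ker {M ι : Type} [Fintype ι] [AddCommGroup M] [Module 𝕊 M]
    {𝓜 : ℤ → AddSubgroup M} {d : ℤ} {deg : ι → ℕ} {φ : (ι → 𝕊) →ₗ[𝕊] M}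
    (hp : Pres 𝓜 deg φ) (hd : ∀ k, (deg k : ℤ) ≤ d)
    (h : ∀ n, Q (K := K) (σ := σ) n M 𝓜 d) (n : ℕ) :
    Q (K := K) (σ := σ) n (LinearMap.ker φ) (subG (LinearMap.ker φ) (FG deg)) (d + 1) := by
  cases n with
  | zero => trivial
  | succ n =>
    obtain ⟨κ, hκ, deg', φ', h1, h2, h3⟩ := h (n + 2)
    have hl : ∀ k, ∃ b, b ∈ FG deg (deg' k) ∧ φ b = φ' (Pi.single k 1) := fun k =>
      hp.grsurj _ _ (h2.gr _ _ (single_mem_FG deg' k))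
    choose b hb hgb using hl
    let lam : (κ → 𝕊) →ₗ[𝕊] (ι → 𝕊) := Fintype.linearCombination 𝕊 b
    have hlam : ∀ y, lam y = ∑ k, y k • b k := fun y => rfl
    have hglam : ∀ y, φ (lam y) = φ' y := by
      intro y
      rw [hlam, map_sum, lin_eq_sum φ' y]
      simp [hgb]
    have hlamgr : ∀ j y, y ∈ FG deg' j → lam y ∈ FG deg j := by
      intro j y hy
      rw [hlam]
      refine sum_mem fun k _ => ?_
      have := GS_FG _ _ _ _ _ (hy k) (hb k)
      simpa using this
    let P : Submodule 𝕊 ((ι → 𝕊) × (κ → 𝕊)) :=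
      LinearMap.ker (φ ∘ₗ LinearMap.fst 𝕊 _ _ - φ' ∘ₗ LinearMap.snd 𝕊 _ _)
    have hP : ∀ x y, (x, y) ∈ P ↔ φ x = φ' y := by
      intro x y
      rw [LinearMap.mem_ker]
      change φ x - φ' y = 0 ↔ _
      rw [sub_eq_zero]
    have hPG : GS (K := K) (σ := σ) (subG P (prodG (FG deg) (FG deg'))) :=
      GS_subG _ (GS_prodG (GS_FG _) (GS_FG _))
    have hQP : Q (K := K) (σ := σ) (n + 1) P (subG P (prodG (FG deg) (FG deg'))) (d + 1) := by
      have hin : ∀ y ∈ LinearMap.ker φ', LinearMap.inr 𝕊 (ι → 𝕊) (κ → 𝕊) y ∈ P := by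
        intro y hy
        rw [LinearMap.mem_ker] at hy
        change (0, y) ∈ P
        rw [hP, hy, map_zero]
      refine Q_ext (n + 1) (f := (LinearMap.inr 𝕊 (ι → 𝕊) (κ → 𝕊)).restrict hin)
        (g := LinearMap.fst 𝕊 _ _ ∘ₗ P.subtype) ⟨?_, ?_, ?_, ?_, ?_, ?_, ?_⟩ hPG h3
        (Q_free (n + 1) deg fun k => (hd k).trans (by omega))
      · intro x y hxy
        ext1
        exact congrArg (fun z : P => (z : (ι → 𝕊) × (κ → 𝕊)).2) hxy
      · intro x
        obtain ⟨y, hy⟩ := h2.surj (φ x)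
        exact ⟨⟨(x, y), (hP _ _).2 hy.symm⟩, rfl⟩
      · intro a; rfl
      · rintro ⟨⟨x, y⟩, hxy⟩ h0
        have h0 : x = 0 := h0
        subst h0
        refine ⟨⟨y, ?_⟩, rfl⟩
        rw [hP, map_zero] at hxy
        exact hxy.symm
      · rintro j ⟨y, hy⟩
        exact ⟨fun h => h.2, fun h => ⟨zero_mem _, h⟩⟩
      · rintro j ⟨y, hy⟩ h
        exact h.1
      · intro j x hx
        obtain ⟨y, hy, hyx⟩ := h2.grsurj j (φ x) (hp.gr _ _ hx)
        exact ⟨⟨(x, y), (hP _ _).2 hyx.symm⟩, ⟨hx, hy⟩, rfl⟩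
    let f : (κ → 𝕊) →ₗ[𝕊] P := LinearMap.codRestrict P (LinearMap.prod lam LinearMap.id)
      (fun y => (hP _ _).2 (hglam y))
    let g : P →ₗ[𝕊] LinearMap.ker φ := LinearMap.codRestrict _
      ((LinearMap.fst 𝕊 _ _ - lam ∘ₗ LinearMap.snd 𝕊 _ _) ∘ₗ P.subtype) (by
        rintro ⟨⟨x, y⟩, hxy⟩
        rw [hP] at hxy
        rw [LinearMap.mem_ker]
        change φ (x - lam y) = 0
        rw [map_sub, hglam, hxy, sub_self])
    refine Q_cone n (f := f) (g := g) ⟨?_, ?_, ?_, ?_, ?_, ?_, ?_⟩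
      (Q_free n deg' fun k => (h1 k).trans (by omega)) hQP
    · intro x y hxy
      exact congrArg (fun z : P => (z : (ι → 𝕊) × (κ → 𝕊)).2) hxy
    · rintro ⟨x, hx⟩
      refine ⟨⟨(x, 0), ?_⟩, ?_⟩
      · rw [hP, map_zero]; exact hx
      · ext1
        change x - lam 0 = x
        simp
    · intro y
      ext1
      change lam y - lam y = 0
      exact sub_self _
    · rintro ⟨⟨x, y⟩, hxy⟩ h0
      have h0 : x - lam y = 0 := congrArg Subtype.val h0
      rw [sub_eq_zero] at h0
      subst h0
      exact ⟨y, rfl⟩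
    · intro j y
      exact ⟨fun h => h.2, fun h => ⟨hlamgr _ _ h, h⟩⟩
    · rintro j ⟨⟨x, y⟩, hxy⟩ h
      exact (FG deg j).sub_mem h.1 (hlamgr _ _ h.2)
    · rintro j ⟨x, hx⟩ h
      refine ⟨⟨(x, 0), ?_⟩, ⟨h, zero_mem _⟩, ?_⟩
      · rw [hP, map_zero]; exact hx
      · ext1
        change x - lam 0 = x
        simp

theorem Q_step {M : Type} [AddCommGroup M] [Module 𝕊 M]
    {𝓜 : ℤ → AddSubgroup M} {d : ℤ} (h : ∀ n, Q (K := K) (σ := σ) n M 𝓜 d) :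
    ∃ (m : ℕ) (deg : Fin m → ℕ) (φ : (Fin m → 𝕊) →ₗ[𝕊] M), Pres 𝓜 deg φ ∧
      (∀ k, (deg k : ℤ) ≤ d) ∧
      ∀ n, Q (K := K) (σ := σ) n (LinearMap.ker φ) (subG (LinearMap.ker φ) (FG deg)) (d + 1) := by
  obtain ⟨ι, hι, deg, φ, h1, h2, -⟩ := h 1
  let e := Fintype.equivFin ι
  let ψ := φ ∘ₗ LinearMap.funLeft 𝕊 𝕊 e
  have hψ : ∀ x, ψ x = φ (x ∘ e) := fun x => rfl
  have hψ' : ∀ x, ψ (x ∘ e.symm) = φ x := by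
    intro x
    rw [hψ]; congr 1; ext i; simp
  have hp : Pres 𝓜 (deg ∘ e.symm) ψ := by
    refine ⟨?_, ?_, ?_⟩
    · intro m
      obtain ⟨x, hx⟩ := h2.surj m
      exact ⟨x ∘ e.symm, by rw [hψ', hx]⟩
    · intro j x hx
      refine h2.gr _ _ fun k => ?_
      have := hx (e k)
      simpa using this
    · intro j m hm
      obtain ⟨x, hx, hxm⟩ := h2.grsurj j m hm
      exact ⟨x ∘ e.symm, fun k => hx (e.symm k), by rw [hψ', hxm]⟩
  exact ⟨_, deg ∘ e.symm, ψ, hp, fun k => h1 _, Q_ker hp (fun k => h1 _) h⟩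

/-- The predicate for ideals. -/
def QI (n : ℕ) (I : Ideal 𝕊) (d : ℤ) : Prop :=
  Q (K := K) (σ := σ) n I (subG I (SG K σ)) d

theorem QI_mv (n : ℕ) {I J : Ideal 𝕊} (hI : ∀ f ∈ I, ∀ j, pr j f ∈ I)
    (hJ : ∀ f ∈ J, ∀ j, pr j f ∈ J) {d : ℤ} (h1 : QI n I d) (h2 : QI n J d)
    (h3 : QI n (I ⊓ J) (d + 1)) : QI n (I ⊔ J) d := by
  cases n with
  | zero => trivial
  | succ n =>
  let f : (I ⊓ J : Ideal 𝕊) →ₗ[𝕊] I × J :=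
    LinearMap.prod (Submodule.inclusion inf_le_left) (-Submodule.inclusion inf_le_right)
  let g : I × J →ₗ[𝕊] (I ⊔ J : Ideal 𝕊) :=
    LinearMap.coprod (Submodule.inclusion le_sup_left) (Submodule.inclusion le_sup_right)
  refine Q_cone n (f := f) (g := g) (𝓐 := subG _ (SG K σ)) ⟨?_, ?_, ?_, ?_, ?_, ?_, ?_⟩ (Q_pred _ h3)
    (Q_prod (n + 1) (GS_subG _ GS_SG) (GS_subG _ GS_SG) h1 h2)
  · intro x y hxy
    ext1
    exact congrArg (fun z : I × J => (z.1 : 𝕊)) hxy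
  · rintro ⟨z, hz⟩
    obtain ⟨x, hx, y, hy, rfl⟩ := Submodule.mem_sup.1 hz
    exact ⟨(⟨x, hx⟩, ⟨y, hy⟩), rfl⟩
  · rintro ⟨x, hx⟩
    ext1
    change x + -x = 0
    simp
  · rintro ⟨⟨x, hx⟩, ⟨y, hy⟩⟩ h0
    have h0 : x + y = 0 := congrArg Subtype.val h0
    have h0' : y = -x := (neg_eq_of_add_eq_zero_right h0).symm
    subst h0'
    exact ⟨⟨x, hx, by simpa using hy⟩, rfl⟩
  · rintro j ⟨x, hx⟩
    exact ⟨fun h => h.1, fun h => ⟨h, neg_mem (S := AddSubgroup 𝕊) (s := SG K σ j) h⟩⟩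
  · rintro j ⟨⟨x, hx⟩, ⟨y, hy⟩⟩ h
    exact add_mem (S := AddSubgroup 𝕊) (s := SG K σ j) h.1 h.2
  · rintro j ⟨z, hz⟩ h
    have h : z ∈ SG K σ j := h
    obtain ⟨x, hx, y, hy, rfl⟩ := Submodule.mem_sup.1 hz
    refine ⟨(⟨pr j x, hI x hx j⟩, ⟨pr j y, hJ y hy j⟩), ⟨pr_mem j x, pr_mem j y⟩, ?_⟩
    ext1
    change pr j x + pr j y = x + y
    rw [← pr_of_mem h]
    ext a
    simp only [coeff_add, coeff_pr]
    split_ifs <;> simp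

theorem QI_bot (n : ℕ) (d : ℤ) : QI n (⊥ : Ideal 𝕊) d := Q_subsingleton n

theorem QI_principal (n : ℕ) (a : σ →₀ ℕ) :
    QI n (Ideal.span {(monomial a 1 : 𝕊)}) (a.degree : ℤ) := by
  have hne : (monomial a 1 : 𝕊) ≠ 0 := by simp
  have hmem : ∀ x : Unit → 𝕊, x () * monomial a 1 ∈ Ideal.span {(monomial a 1 : 𝕊)} := fun x =>
    Ideal.mul_mem_left _ _ (Ideal.subset_span rfl)
  let e0 : (Unit → 𝕊) →ₗ[𝕊] Ideal.span {(monomial a 1 : 𝕊)} :=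
    { toFun := fun x => ⟨x () * monomial a 1, hmem x⟩
      map_add' := fun x y => by ext1; simp [add_mul]
      map_smul' := fun s x => by ext1; simp [mul_assoc] }
  have hb : Function.Bijective e0 := by
    constructor
    · intro x y hxy
      have : x () * monomial a 1 = y () * monomial a 1 := congrArg Subtype.val hxy
      funext u
      exact mul_right_cancel₀ hne this
    · rintro ⟨z, hz⟩
      obtain ⟨y, rfl⟩ := Ideal.mem_span_singleton'.1 hz
      exact ⟨fun _ => y, rfl⟩
  refine Q_iso n (LinearEquiv.ofBijective e0 hb) ?_
    (Q_free n (fun _ : Unit => a.degree) fun _ => le_rfl)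
  intro j x
  change x () * monomial a 1 ∈ SG K σ j ↔ _
  constructor
  · rintro h ⟨⟩
    rw [mem_SG] at *
    intro b hb
    have := h (b + a) (by rw [coeff_mul_monomial]; simpa using hb)
    rw [map_add] at this
    push_cast at this
    change (b.degree : ℤ) = j - (a.degree : ℤ)
    omega
  · intro h
    have h1 : (monomial a 1 : 𝕊) ∈ SG K σ (a.degree : ℤ) := by
      rw [mem_SG]
      intro b hb
      rw [coeff_monomial] at hb
      have : a = b := by by_contra h; simp [h] at hb
      rw [this]
    have := SG_mul (h ()) h1
    simpa using this

end core3
end EdgeIdealReg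

namespace EdgeIdealReg
open scoped Classical

section mono
variable {K : Type} [Field K] {σ : Type}

local notation "𝕊" => MvPolynomial σ K

/-- The monomial ideal generated by the monomials with exponents in `E`. -/
def mI (K : Type) [Field K] {σ : Type} (E : Set (σ →₀ ℕ)) : Ideal (MvPolynomial σ K) :=
  Ideal.span ((fun s => monomial s (1 : K)) '' E)

theorem mem_mI {E : Set (σ →₀ ℕ)} {f : 𝕊} :
    f ∈ mI K E ↔ ∀ a, coeff a f ≠ 0 → ∃ e ∈ E, e ≤ a := by
  unfold mI
  rw [mem_ideal_span_monomial_image]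
  simp [mem_support_iff]

theorem mem_mI' {E : Set (σ →₀ ℕ)} (hE : IsUpperSet E) {f : 𝕊} :
    f ∈ mI K E ↔ ∀ a, coeff a f ≠ 0 → a ∈ E := by
  rw [mem_mI]
  constructor
  · intro h a ha
    obtain ⟨e, he, hea⟩ := h a ha
    exact hE hea he
  · exact fun h a ha => ⟨a, h a ha, le_rfl⟩

theorem pr_mI (E : Set (σ →₀ ℕ)) : ∀ f ∈ mI K E, ∀ j, pr j f ∈ mI K E := by
  intro f hf j
  rw [mem_mI] at *
  intro a ha
  rw [coeff_pr] at ha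
  exact hf a (by intro h; simp [h] at ha)

theorem monomial_mem_mI {E : Set (σ →₀ ℕ)} {a : σ →₀ ℕ} :
    (monomial a 1 : 𝕊) ∈ mI K E ↔ ∃ e ∈ E, e ≤ a := by
  rw [mem_mI]
  constructor
  · intro h
    exact h a (by simp)
  · intro h b hb
    rw [coeff_monomial] at hb
    have : a = b := by by_contra h; simp [h] at hb
    rwa [← this]

theorem mI_sup (E F : Set (σ →₀ ℕ)) : mI K E ⊔ mI K F = mI K (E ∪ F) := by
  unfold mI
  rw [Set.image_union, Ideal.span_union]

theorem mI_inf {E F : Set (σ →₀ ℕ)} (hE : IsUpperSet E) (hF : IsUpperSet F) :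
    mI K E ⊓ mI K F = mI K (E ∩ F) := by
  ext f
  rw [Ideal.mem_inf, mem_mI' hE, mem_mI' hF, mem_mI' (hE.inter hF)]
  constructor
  · exact fun h a ha => ⟨h.1 a ha, h.2 a ha⟩
  · exact fun h => ⟨fun a ha => (h a ha).1, fun a ha => (h a ha).2⟩

theorem mI_univ_QI (n : ℕ) {E : Set (σ →₀ ℕ)} (h : (0 : σ →₀ ℕ) ∈ E) : QI n (mI K E) 0 := by
  have h1 := QI_principal (K := K) n (0 : σ →₀ ℕ)
  have h2 : mI K E = Ideal.span {(monomial 0 1 : 𝕊)} := by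
    have e1 : mI K E = ⊤ := (Ideal.eq_top_iff_one _).2 (Ideal.subset_span ⟨0, h, rfl⟩)
    have e2 : Ideal.span {(monomial 0 1 : 𝕊)} = ⊤ :=
      (Ideal.eq_top_iff_one _).2 (Ideal.subset_span rfl)
    rw [e1, e2]
  rw [h2]
  simpa using h1

/-- Finitely generated monomial ideals have finite regularity. -/
theorem exists_QI (k : ℕ) : ∀ E : Finset (σ →₀ ℕ), E.card ≤ k →
    ∃ d : ℤ, ∀ n, QI n (mI K (E : Set (σ →₀ ℕ))) d := by
  induction k with
  | zero =>
    intro E hE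
    have : E = ∅ := by simpa using hE
    subst this
    refine ⟨0, fun n => ?_⟩
    have : mI K ((∅ : Finset (σ →₀ ℕ)) : Set (σ →₀ ℕ)) = ⊥ := by simp [mI]
    rw [this]
    exact QI_bot n 0
  | succ k ih =>
    intro E hE
    rcases E.eq_empty_or_nonempty with rfl | ⟨m, hm⟩
    · exact ih ∅ (by simp)
    have hc : (E.erase m).card ≤ k := by
      rw [Finset.card_erase_of_mem hm]; omega
    obtain ⟨d1, h1⟩ := ih (E.erase m) hc
    obtain ⟨d2, h2⟩ := ih ((E.erase m).image (fun e => e ⊔ m)) (Finset.card_image_le.trans hc)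
    have hsup : mI K (E : Set (σ →₀ ℕ)) = mI K ((E.erase m : Finset _) : Set (σ →₀ ℕ)) ⊔ mI K {m} := by
      rw [mI_sup]
      congr 1
      ext x
      simp only [Finset.coe_erase, Set.mem_union, Set.mem_sdiff, Set.mem_singleton_iff,
        SetLike.mem_coe]
      by_cases hx : x = m
      · simp [hx, hm]
      · simp [hx]
    have hinf : mI K ((E.erase m : Finset _) : Set (σ →₀ ℕ)) ⊓ mI K {m} =
        mI K (((E.erase m).image (fun e => e ⊔ m) : Finset _) : Set (σ →₀ ℕ)) := by
      ext f
      rw [Ideal.mem_inf, mem_mI, mem_mI, mem_mI]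
      constructor
      · rintro ⟨ha, hb⟩ a hane
        obtain ⟨e, he, hea⟩ := ha a hane
        obtain ⟨e', he', hea'⟩ := hb a hane
        rw [Set.mem_singleton_iff] at he'
        subst he'
        exact ⟨e ⊔ e', Finset.mem_coe.2 (Finset.mem_image_of_mem _ he), sup_le hea hea'⟩
      · intro h
        refine ⟨fun a ha => ?_, fun a ha => ?_⟩ <;> obtain ⟨e, he, hea⟩ := h a ha <;>
          obtain ⟨e', he', rfl⟩ := Finset.mem_image.1 (Finset.mem_coe.1 he)
        · exact ⟨e', he', le_sup_left.trans hea⟩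
        · exact ⟨m, rfl, le_sup_right.trans hea⟩
    refine ⟨max d1 (max d2 m.degree), fun n => ?_⟩
    rw [hsup]
    refine QI_mv n (pr_mI _) (pr_mI _) (Q_mono n (le_max_left _ _) (h1 n)) ?_ ?_
    · have := QI_principal (K := K) n m
      unfold mI
      rw [Set.image_singleton]
      exact Q_mono n (by simp) this
    · rw [hinf]
      exact Q_mono n (le_trans (by simp) (Int.le_add_one le_rfl)) (h2 n)

end mono
end EdgeIdealReg

namespace EdgeIdealReg
open scoped Classical

section tensor
variable {K : Type} [Field K] {σ τ W : Type}

local notation "𝕊" => MvPolynomial σ K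
local notation "ℛ" => MvPolynomial τ K

/-- The second module is the extension of the first one to the bigger polynomial ring, restricted to exponents in `E`. -/
structure Ext (A : MvPolynomial σ K ≃+* MvPolynomial W (MvPolynomial τ K)) (E : Set (W →₀ ℕ))
    {M M' : Type} [AddCommGroup M] [AddCommGroup M'] [Module (MvPolynomial τ K) M]
    [Module (MvPolynomial σ K) M'] (𝓜 : ℤ → AddSubgroup M) (𝓜' : ℤ → AddSubgroup M')
    (c : (W →₀ ℕ) → M' →+ M) : Prop where
  inj : ∀ x y, (∀ b, c b x = c b y) → x = y
  fin : ∀ x, ∃ s : Finset (W →₀ ℕ), ∀ b, b ∉ s → c b x = 0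
  zero : ∀ x b, b ∉ E → c b x = 0
  surj : ∀ b ∈ E, ∀ m, ∃ x, ∀ b', c b' x = if b' = b then m else 0
  smul : ∀ s x b, c b (s • x) =
    ∑ p ∈ Finset.HasAntidiagonal.antidiagonal b, coeff p.1 (A s) • c p.2 x
  gr : ∀ j x, x ∈ 𝓜' j ↔ ∀ b, c b x ∈ 𝓜 (j - b.degree)

theorem Q_tensor {A : MvPolynomial σ K ≃+* MvPolynomial W (MvPolynomial τ K)}
    (hA : ∀ f j, f ∈ SG K σ j ↔ ∀ b, coeff b (A f) ∈ SG K τ (j - b.degree))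
    {E : Set (W →₀ ℕ)} {J : Ideal 𝕊} (hJ : ∀ f, f ∈ J ↔ ∀ b, b ∉ E → coeff b (A f) = 0)
    {e : ℤ} (hQ : ∀ n, QI n J e) (n : ℕ) :
    ∀ {M M' : Type} [AddCommGroup M] [AddCommGroup M'] [Module (MvPolynomial τ K) M]
    [Module (MvPolynomial σ K) M'] {𝓜 : ℤ → AddSubgroup M} {𝓜' : ℤ → AddSubgroup M'}
    {c : (W →₀ ℕ) → M' →+ M} {d : ℤ}, Ext A E 𝓜 𝓜' c →
    Q (K := K) (σ := τ) n M 𝓜 d → Q (K := K) (σ := σ) n M' 𝓜' (d + e) := by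
  induction n with
  | zero => intros; trivial
  | succ n ih =>
    rintro M M' _ _ _ _ 𝓜 𝓜' c d hc ⟨ι, hι, deg, φ, h1, h2, h3⟩
    -- coefficients of elements of `J ^ ι`
    let cL : (W →₀ ℕ) → (ι → J) →+ (ι → ℛ) := fun b =>
      { toFun := fun l k => coeff b (A (l k))
        map_zero' := by ext1 k; simp
        map_add' := fun x y => by ext1 k; simp }
    have hcL : ∀ b l k, cL b l k = coeff b (A (l k)) := fun b l k => rfl
    have hcLinj : ∀ x y, (∀ b, cL b x = cL b y) → x = y := by
      intro x y h
      funext k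
      ext1
      apply A.injective
      apply MvPolynomial.ext
      exact fun b => congrFun (h b) k
    have hcLfin : ∀ x, ∃ s : Finset (W →₀ ℕ), ∀ b, b ∉ s → cL b x = 0 := by
      intro x
      refine ⟨Finset.univ.biUnion fun k => (A (x k)).support, fun b hb => ?_⟩
      ext1 k
      by_contra h
      exact hb (Finset.mem_biUnion.2 ⟨k, Finset.mem_univ _, mem_support_iff.2 h⟩)
    have hcLzero : ∀ x b, b ∉ E → cL b x = 0 := by
      intro x b hb
      ext1 k
      exact (hJ _).1 (x k).2 b hb
    have hcLsurj : ∀ (s : Finset (W →₀ ℕ)) (x : (W →₀ ℕ) → ι → ℛ), (∀ b ∈ s, b ∈ E) →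
        ∃ l, ∀ b, cL b l = if b ∈ s then x b else 0 := by
      intro s x hs
      have hco : ∀ k b, coeff b (∑ b' ∈ s, monomial b' (x b' k)) = if b ∈ s then x b k else 0 := by
        intro k b
        rw [coeff_sum]
        simp only [coeff_monomial]
        rw [Finset.sum_ite_eq']
      refine ⟨fun k => ⟨A.symm (∑ b' ∈ s, monomial b' (x b' k)), ?_⟩, ?_⟩
      · rw [hJ]
        intro b hb
        rw [A.apply_symm_apply, hco, if_neg fun h => hb (hs b h)]
      · intro b
        ext1 k
        rw [hcL]
        simp only [A.apply_symm_apply]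
        rw [hco]
        split_ifs <;> rfl
    have hcLsmul : ∀ s x b, cL b (s • x) =
        ∑ p ∈ Finset.HasAntidiagonal.antidiagonal b, coeff p.1 (A s) • cL p.2 x := by
      intro s x b
      ext1 k
      rw [hcL, Finset.sum_apply]
      change coeff b (A (s * x k)) = _
      rw [map_mul, coeff_mul]
      rfl
    have hcLgr : ∀ j x, x ∈ piG deg (subG J (SG K σ)) j ↔
        ∀ b, cL b x ∈ FG deg (j - b.degree) := by
      intro j x
      change (∀ k, (x k : 𝕊) ∈ SG K σ (j - deg k)) ↔ ∀ b k, _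
      simp only [hA, hcL]
      rw [forall_comm]
      simp only [sub_right_comm]
    -- the induced map
    have hex : ∀ l : ι → J, ∃ x : M', ∀ b, c b x = φ (cL b l) := by
      intro l
      obtain ⟨s, hs⟩ := hcLfin l
      have hx : ∀ b, ∃ x : M', ∀ b', c b' x = if b' = b then φ (cL b l) else 0 := by
        intro b
        by_cases hb : b ∈ E
        · exact hc.surj b hb _
        · refine ⟨0, fun b' => ?_⟩
          rw [map_zero, hcLzero l b hb, map_zero, ite_self]
      choose x hx using hx
      refine ⟨∑ b ∈ s, x b, fun b => ?_⟩
      rw [map_sum]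
      simp only [hx]
      rw [Finset.sum_ite_eq]
      split_ifs with h
      · rfl
      · rw [hs b h, map_zero]
    choose Φ0 hΦ0 using hex
    let Φ : (ι → J) →ₗ[𝕊] M' :=
      { toFun := Φ0
        map_add' := by
          intro x y
          apply hc.inj
          intro b
          rw [map_add, hΦ0, hΦ0, hΦ0, map_add, map_add]
        map_smul' := by
          intro s x
          apply hc.inj
          intro b
          rw [RingHom.id_apply, hc.smul, hΦ0, hcLsmul, map_sum]
          refine Finset.sum_congr rfl fun p _ => ?_
          rw [hΦ0, map_smul] }
    have hΦ : ∀ l b, c b (Φ l) = φ (cL b l) := hΦ0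
    have hlift : ∀ (m : M') (x : (W →₀ ℕ) → ι → ℛ), (∀ b, φ (x b) = c b m) →
        ∃ l, Φ l = m ∧ ∀ b, cL b l = x b ∨ cL b l = 0 := by
      intro m x hx
      obtain ⟨s, hs⟩ := hc.fin m
      obtain ⟨l, hl⟩ := hcLsurj (s.filter (· ∈ E)) x (fun b hb => (Finset.mem_filter.1 hb).2)
      refine ⟨l, ?_, ?_⟩
      · apply hc.inj
        intro b
        rw [hΦ, hl]
        split_ifs with h
        · exact hx b
        · rw [map_zero]
          rw [Finset.mem_filter, not_and_or] at h
          rcases h with h | h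
          · exact (hs b h).symm
          · exact (hc.zero m b h).symm
      · intro b
        rw [hl]
        split_ifs
        · exact Or.inl rfl
        · exact Or.inr rfl
    let c' : (W →₀ ℕ) → LinearMap.ker Φ →+ LinearMap.ker φ := fun b =>
      { toFun := fun l => ⟨cL b l, by
          rw [LinearMap.mem_ker, ← hΦ, LinearMap.mem_ker.1 l.2, map_zero]⟩
        map_zero' := by ext1; exact map_zero _
        map_add' := fun x y => by ext1; exact map_add _ _ _ }
    have hc'val : ∀ b l, (c' b l : ι → ℛ) = cL b l := fun b l => rfl
    have hker : Ext A E (subG (LinearMap.ker φ) (FG deg))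
        (subG (LinearMap.ker Φ) (piG deg (subG J (SG K σ)))) c' := by
      refine ⟨?_, ?_, ?_, ?_, ?_, ?_⟩
      · intro x y h
        ext1
        exact hcLinj _ _ fun b => congrArg Subtype.val (h b)
      · intro x
        obtain ⟨s, hs⟩ := hcLfin x
        exact ⟨s, fun b hb => Subtype.ext (hs b hb)⟩
      · intro x b hb
        exact Subtype.ext (hcLzero _ b hb)
      · rintro b hb ⟨y, hy⟩
        obtain ⟨l, hl⟩ := hcLsurj {b} (fun _ => y) (by simpa using hb)
        refine ⟨⟨l, ?_⟩, fun b' => ?_⟩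
        · rw [LinearMap.mem_ker]
          apply hc.inj
          intro b'
          rw [hΦ, hl, map_zero]
          split_ifs
          · exact hy
          · exact map_zero _
        · ext1
          rw [hc'val, hl]
          simp only [Finset.mem_singleton]
          split_ifs <;> rfl
      · intro s x b
        ext1
        rw [hc'val]
        have := hcLsmul s x b
        rw [Submodule.coe_sum]
        exact this
      · intro j x
        exact hcLgr j x
    have hQk := ih hker h3
    have hQL : Q (K := K) (σ := σ) (n + 1) (ι → J) (piG deg (subG J (SG K σ))) (d + e) :=
      Q_pi (n + 1) h1 (hQ (n + 1))
    refine Q_cone n (f := (LinearMap.ker Φ).subtype) (g := Φ) ⟨?_, ?_, ?_, ?_, ?_, ?_, ?_⟩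
      (Q_mono n (by omega) hQk) hQL
    · exact Subtype.val_injective
    · intro m
      choose x hx using fun b => h2.surj (c b m)
      obtain ⟨l, hl, -⟩ := hlift m x hx
      exact ⟨l, hl⟩
    · exact fun a => a.2
    · exact fun b hb => ⟨⟨b, hb⟩, rfl⟩
    · exact fun j a => Iff.rfl
    · intro j l hl
      rw [hc.gr]
      intro b
      rw [hΦ]
      exact h2.gr _ _ ((hcLgr _ _).1 hl b)
    · intro j m hm
      rw [hc.gr] at hm
      choose x hx hxm using fun b => h2.grsurj _ (c b m) (hm b)
      obtain ⟨l, hl, hlx⟩ := hlift m x hxm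
      refine ⟨l, ?_, hl⟩
      rw [hcLgr]
      intro b
      rcases hlx b with h | h
      · rw [h]; exact hx b
      · rw [h]; exact zero_mem _

/-- The ideal version. -/
theorem QI_tensor {A : MvPolynomial σ K ≃+* MvPolynomial W (MvPolynomial τ K)}
    (hA : ∀ f j, f ∈ SG K σ j ↔ ∀ b, coeff b (A f) ∈ SG K τ (j - b.degree))
    {E : Set (W →₀ ℕ)} {J : Ideal 𝕊} (hJ : ∀ f, f ∈ J ↔ ∀ b, b ∉ E → coeff b (A f) = 0)
    {e : ℤ} (hQ : ∀ n, QI n J e) (n : ℕ) {I : Ideal ℛ} {L : Ideal 𝕊}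
    (hL : ∀ f, f ∈ L ↔ (∀ b, coeff b (A f) ∈ I) ∧ ∀ b, b ∉ E → coeff b (A f) = 0)
    {d : ℤ} (hI : QI n I d) : QI n L (d + e) := by
  let c : (W →₀ ℕ) → L →+ I := fun b =>
    { toFun := fun l => ⟨coeff b (A l), ((hL _).1 l.2).1 b⟩
      map_zero' := by ext1; simp
      map_add' := fun x y => by ext1; simp }
  have hcv : ∀ b l, (c b l : ℛ) = coeff b (A l) := fun b l => rfl
  refine Q_tensor hA hJ hQ n (c := c) ⟨?_, ?_, ?_, ?_, ?_, ?_⟩ hI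
  · intro x y h
    ext1
    apply A.injective
    apply MvPolynomial.ext
    exact fun b => congrArg Subtype.val (h b)
  · intro x
    refine ⟨(A x).support, fun b hb => ?_⟩
    exact Subtype.ext (MvPolynomial.notMem_support_iff.1 hb)
  · intro x b hb
    ext1
    exact ((hL _).1 x.2).2 b hb
  · rintro b hb ⟨m, hm⟩
    refine ⟨⟨A.symm (monomial b m), ?_⟩, fun b' => ?_⟩
    · rw [hL]
      simp only [A.apply_symm_apply, coeff_monomial]
      refine ⟨fun b' => ?_, fun b' hb' => ?_⟩
      · split_ifs
        · exact hm
        · exact zero_mem _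
      · rw [if_neg]
        rintro rfl
        exact hb' hb
    · ext1
      rw [hcv]
      simp only [A.apply_symm_apply, coeff_monomial]
      by_cases h : b = b'
      · simp [h]
      · rw [if_neg h, if_neg (Ne.symm h)]; rfl
  · intro s x b
    ext1
    rw [hcv, Submodule.coe_sum]
    change coeff b (A (s * x)) = _
    rw [map_mul, coeff_mul]
    rfl
  · intro j x
    exact hA x j

end tensor
end EdgeIdealReg

namespace EdgeIdealReg
open scoped Classical

section sumring
variable {K : Type} [Field K] {σ τ W : Type}

theorem tensor_mI {A : MvPolynomial σ K ≃+* MvPolynomial W (MvPolynomial τ K)}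
    {e : (W →₀ ℕ) → (τ →₀ ℕ) → (σ →₀ ℕ)}
    (hc : ∀ f b a, coeff a (coeff b (A f)) = coeff (e b a) f)
    (hdeg : ∀ b a, (e b a).degree = b.degree + a.degree)
    (hs : ∀ c, ∃ b a, e b a = c)
    {E : Set (W →₀ ℕ)} {T : Set (τ →₀ ℕ)} (hT : IsUpperSet T)
    {F F' : Set (σ →₀ ℕ)} (hFu : IsUpperSet F) (hFu' : IsUpperSet F')
    (hF : ∀ b a, e b a ∈ F ↔ b ∈ E) (hF' : ∀ b a, e b a ∈ F' ↔ a ∈ T ∧ b ∈ E)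
    {d d' : ℤ} (hQ : ∀ n, QI n (mI K F) d') (n : ℕ) (hI : QI n (mI K T) d) :
    QI n (mI K F') (d + d') := by
  refine QI_tensor (A := A) ?_ (E := E) ?_ hQ n ?_ hI
  · intro f j
    simp only [mem_SG, hc]
    constructor
    · intro h b a ha
      have := h _ ha
      rw [hdeg] at this
      push_cast at this
      omega
    · intro h c hc
      obtain ⟨b, a, rfl⟩ := hs c
      have := h b a hc
      rw [hdeg]
      push_cast
      omega
  · intro f
    rw [mem_mI' hFu]
    constructor
    · intro h b hb
      ext a
      rw [hc, coeff_zero]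
      by_contra h0
      exact hb ((hF _ _).1 (h _ h0))
    · intro h c h0
      obtain ⟨b, a, rfl⟩ := hs c
      rw [hF]
      by_contra hb
      apply h0
      rw [← hc, h b hb, coeff_zero]
  · intro f
    rw [mem_mI' hFu']
    simp only [mem_mI' hT, hc]
    constructor
    · intro h
      refine ⟨fun b a h0 => ((hF' _ _).1 (h _ h0)).1, fun b hb => ?_⟩
      ext a
      rw [hc, coeff_zero]
      by_contra h0
      exact hb ((hF' _ _).1 (h _ h0)).2
    · rintro ⟨h1, h2⟩ c h0
      obtain ⟨b, a, rfl⟩ := hs c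
      rw [hF']
      refine ⟨h1 b a h0, ?_⟩
      by_contra hb
      apply h0
      rw [← hc, h2 b hb, coeff_zero]

theorem sumElim_degree (b : τ →₀ ℕ) (a : W →₀ ℕ) :
    (Finsupp.sumElim b a).degree = b.degree + a.degree := by
  have h1 : ∀ c : τ →₀ ℕ, (Finsupp.sumElim c (0 : W →₀ ℕ)).degree = c.degree := by
    intro c
    rw [Finsupp.sumElim_eq_add, Finsupp.mapDomain_zero, add_zero]
    induction c using Finsupp.induction_linear with
    | zero => simp
    | add f g hf hg => rw [Finsupp.mapDomain_add, map_add, map_add, hf, hg]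
    | single x n => rw [Finsupp.mapDomain_single]; simp
  have h2 : ∀ c : W →₀ ℕ, (Finsupp.sumElim (0 : τ →₀ ℕ) c).degree = c.degree := by
    intro c
    rw [Finsupp.sumElim_eq_add, Finsupp.mapDomain_zero, zero_add]
    induction c using Finsupp.induction_linear with
    | zero => simp
    | add f g hf hg => rw [Finsupp.mapDomain_add, map_add, map_add, hf, hg]
    | single x n => rw [Finsupp.mapDomain_single]; simp
  have : Finsupp.sumElim b a = Finsupp.sumElim b 0 + Finsupp.sumElim 0 a := by
    simp [Finsupp.sumElim_eq_add]
  rw [this, map_add, h1, h2]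

/-- left and right parts of an exponent -/
def lp (c : τ ⊕ W →₀ ℕ) : τ →₀ ℕ := Finsupp.comapDomain Sum.inl c Sum.inl_injective.injOn
def rp (c : τ ⊕ W →₀ ℕ) : W →₀ ℕ := Finsupp.comapDomain Sum.inr c Sum.inr_injective.injOn

theorem lp_apply (c : τ ⊕ W →₀ ℕ) (v) : lp c v = c (Sum.inl v) := rfl
theorem rp_apply (c : τ ⊕ W →₀ ℕ) (v) : rp c v = c (Sum.inr v) := rfl
theorem lp_sumElim (b : τ →₀ ℕ) (a : W →₀ ℕ) : lp (Finsupp.sumElim b a) = b := by ext; rfl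
theorem rp_sumElim (b : τ →₀ ℕ) (a : W →₀ ℕ) : rp (Finsupp.sumElim b a) = a := by ext; rfl
theorem sumElim_lp_rp (c : τ ⊕ W →₀ ℕ) : Finsupp.sumElim (lp c) (rp c) = c :=
  Finsupp.comapDomain_sumElim_comapDomain c
theorem lp_mono {c c' : τ ⊕ W →₀ ℕ} (h : c ≤ c') : lp c ≤ lp c' := fun v => h (Sum.inl v)
theorem rp_mono {c c' : τ ⊕ W →₀ ℕ} (h : c ≤ c') : rp c ≤ rp c' := fun v => h (Sum.inr v)

theorem sumAlgEquiv_monomial (c : τ ⊕ W →₀ ℕ) (r : K) :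
    sumAlgEquiv K τ W (monomial c r) = monomial (lp c) (monomial (rp c) r) := by
  unfold sumAlgEquiv
  rw [AlgEquiv.trans_apply]
  have : (AddMonoidAlgebra.domCongr K K Finsupp.sumFinsuppAddEquivProdFinsupp)
      (monomial c r : MvPolynomial (τ ⊕ W) K) = AddMonoidAlgebra.single (lp c, rp c) r := by
    exact AddMonoidAlgebra.domCongr_single _ _ _
  rw [this, AddMonoidAlgebra.curryAlgEquiv_single]
  rfl

theorem sumAlgEquiv_coeff_aux (c : τ ⊕ W →₀ ℕ) (r : K) (b : τ →₀ ℕ) (a : W →₀ ℕ) :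
    coeff a (coeff b (sumAlgEquiv K τ W (monomial c r))) =
      coeff (Finsupp.sumElim b a) (monomial c r) := by
  rw [sumAlgEquiv_monomial, coeff_monomial, coeff_monomial]
  by_cases h : c = Finsupp.sumElim b a
  · subst h
    simp [lp_sumElim, rp_sumElim]
  · rw [if_neg h]
    split_ifs with h1
    · rw [coeff_monomial, if_neg]
      rintro h2
      exact h (by rw [← h1, ← h2, sumElim_lp_rp])
    · exact coeff_zero _

theorem sumAlgEquiv_coeff (f : MvPolynomial (τ ⊕ W) K) (b : τ →₀ ℕ) (a : W →₀ ℕ) :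
    coeff a (coeff b (sumAlgEquiv K τ W f)) = coeff (Finsupp.sumElim b a) f := by
  induction f using MvPolynomial.monomial_add_induction_on with
  | C r =>
    exact sumAlgEquiv_coeff_aux 0 r b a
  | monomial_add c r f _ _ ih =>
    rw [map_add, coeff_add, coeff_add, coeff_add, ih, sumAlgEquiv_coeff_aux]

/-- product of two exponent sets -/
def bx (E₁ : Set (τ →₀ ℕ)) (E₂ : Set (W →₀ ℕ)) : Set (τ ⊕ W →₀ ℕ) :=
  {c | lp c ∈ E₁ ∧ rp c ∈ E₂}

theorem bx_upper {E₁ : Set (τ →₀ ℕ)} {E₂ : Set (W →₀ ℕ)} (h₁ : IsUpperSet E₁)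
    (h₂ : IsUpperSet E₂) : IsUpperSet (bx E₁ E₂) :=
  fun _ _ h hc => ⟨h₁ (lp_mono h) hc.1, h₂ (rp_mono h) hc.2⟩

theorem bx_QI {E₁ : Set (τ →₀ ℕ)} {E₂ : Set (W →₀ ℕ)} (h₁ : IsUpperSet E₁)
    (h₂ : IsUpperSet E₂) {d₁ d₂ : ℤ} (q₁ : ∀ n, QI n (mI K E₁) d₁)
    (q₂ : ∀ n, QI n (mI K E₂) d₂) (n : ℕ) : QI n (mI K (bx E₁ E₂)) (d₁ + d₂) := by
  have s1 : ∀ n, QI n (mI K (bx (Set.univ : Set (τ →₀ ℕ)) E₂)) (d₂ + 0) := by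
    intro n
    refine tensor_mI (A := (sumAlgEquiv K τ W).toRingEquiv) (e := Finsupp.sumElim)
      (E := Set.univ) (F := Set.univ)
      sumAlgEquiv_coeff sumElim_degree (fun c => ⟨_, _, sumElim_lp_rp c⟩) h₂
      isUpperSet_univ (bx_upper isUpperSet_univ h₂) ?_ ?_ ?_ n (q₂ n)
    · simp
    · intro b a
      simp [bx, rp_sumElim]
    · intro n
      exact mI_univ_QI n (Set.mem_univ _)
  rw [add_zero] at s1
  refine tensor_mI (A := ((renameEquiv K (Equiv.sumComm τ W)).trans
      (sumAlgEquiv K W τ)).toRingEquiv) (e := fun b a => Finsupp.sumElim a b)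
      (E := E₂) ?_ ?_ (fun c => ⟨_, _, sumElim_lp_rp c⟩) h₁
      (bx_upper isUpperSet_univ h₂) (bx_upper h₁ h₂) ?_ ?_ s1 n (q₁ n)
  · intro f b a
    refine (sumAlgEquiv_coeff _ b a).trans ?_
    rw [← Finsupp.mapDomain_swap_sumElim]
    exact coeff_rename_mapDomain _ (Equiv.sumComm τ W).injective f _
  · intro b a
    rw [sumElim_degree, add_comm]
  · intro b a
    simp [bx, rp_sumElim]
  · intro b a
    simp [bx, rp_sumElim, lp_sumElim]

end sumring
end EdgeIdealReg

namespace EdgeIdealReg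
open scoped Classical

section symb
variable {K : Type} [Field K] {V : Type}

/-- Weight of an exponent on a vertex set. -/
def wt (C : Set V) : (V →₀ ℕ) →+ ℕ := Finsupp.weight (fun v => if v ∈ C then 1 else 0)

theorem wt_single (C : Set V) (v : V) (n : ℕ) :
    wt C (Finsupp.single v n) = if v ∈ C then n else 0 := by
  unfold wt
  rw [Finsupp.weight_single]
  split_ifs <;> simp

theorem wt_mono_set {C D : Set V} (h : C ⊆ D) (a : V →₀ ℕ) : wt C a ≤ wt D a := by
  induction a using Finsupp.induction_linear with
  | zero => simp
  | add f g hf hg => rw [map_add, map_add]; exact add_le_add hf hg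
  | single v n =>
    rw [wt_single, wt_single]
    by_cases hv : v ∈ C
    · rw [if_pos hv, if_pos (h hv)]
    · rw [if_neg hv]; exact Nat.zero_le _

theorem wt_mono (C : Set V) {a b : V →₀ ℕ} (h : a ≤ b) : wt C a ≤ wt C b := by
  obtain ⟨c, rfl⟩ := exists_add_of_le h
  rw [map_add]
  exact Nat.le_add_right _ _

theorem wt_pos {C : Set V} {a : V →₀ ℕ} (h : 1 ≤ wt C a) : ∃ v ∈ C, a v ≠ 0 := by
  by_contra hn
  push Not at hn
  unfold wt at h
  rw [Finsupp.weight_apply, Finsupp.sum] at h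
  have : ∑ v ∈ a.support, a v • (if v ∈ C then 1 else 0) = 0 := by
    apply Finset.sum_eq_zero
    intro v _
    split_ifs with hv
    · simp [hn v hv]
    · simp
  omega

theorem wt_ge {C : Set V} {a : V →₀ ℕ} {v : V} (hv : v ∈ C) : a v ≤ wt C a := by
  have : Finsupp.single v (a v) ≤ a := by
    rw [Finsupp.single_le_iff]
  have h := wt_mono C this
  rwa [wt_single, if_pos hv] at h

/-- The weighting homomorphism. -/
def wh (K : Type) [Field K] {V : Type} (C : Set V) :
    MvPolynomial V K →+* Polynomial (MvPolynomial V K) :=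
  eval₂Hom (Polynomial.C.comp MvPolynomial.C)
    (fun v => Polynomial.monomial (if v ∈ C then 1 else 0) (X v))

theorem wh_monomial (C : Set V) (a : V →₀ ℕ) (r : K) :
    wh K C (monomial a r) = Polynomial.monomial (wt C a) (monomial a r) := by
  have h : ∀ a : V →₀ ℕ, wh K C (monomial a 1) = Polynomial.monomial (wt C a) (monomial a 1) := by
    intro a
    induction a using Finsupp.induction_linear with
    | zero => simp
    | add f g hf hg =>
      have e : (monomial (f + g) 1 : MvPolynomial V K) = monomial f 1 * monomial g 1 := by
        rw [monomial_mul, one_mul]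
      rw [map_add, e, ← Polynomial.monomial_mul_monomial, map_mul, hf, hg]
    | single v n =>
      rw [wt_single]
      have e : (monomial (Finsupp.single v n) 1 : MvPolynomial V K) = X v ^ n := by
        rw [X_pow_eq_monomial]
      rw [e, map_pow]
      unfold wh
      rw [eval₂Hom_X', Polynomial.monomial_pow]
      split_ifs <;> simp
  have e : (monomial a r : MvPolynomial V K) = MvPolynomial.C r * monomial a 1 := by
    rw [C_mul_monomial, mul_one]
  rw [e, map_mul, h]
  have : wh K C (MvPolynomial.C r) = Polynomial.C (MvPolynomial.C r) := by
    unfold wh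
    simp
  rw [this, Polynomial.C_mul_monomial]

theorem wh_coeff (C : Set V) (f : MvPolynomial V K) (k : ℕ) (a : V →₀ ℕ) :
    coeff a ((wh K C f).coeff k) = if wt C a = k then coeff a f else 0 := by
  have h : ∀ c (r : K), coeff a ((wh K C (monomial c r)).coeff k) =
      if wt C a = k then coeff a (monomial c r) else 0 := by
    intro c r
    rw [wh_monomial, Polynomial.coeff_monomial]
    by_cases hc : c = a
    · subst hc
      split_ifs <;> simp
    · rw [coeff_monomial, if_neg hc]
      split_ifs <;> simp [coeff_monomial, hc]
  induction f using MvPolynomial.monomial_add_induction_on with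
  | C r => exact h 0 r
  | monomial_add c r f _ _ ih =>
    rw [map_add, Polynomial.coeff_add, coeff_add, coeff_add, ih, h]
    split_ifs <;> simp

theorem wh_dvd {C : Set V} {f : MvPolynomial V K} {k : ℕ} :
    Polynomial.X ^ k ∣ wh K C f ↔ ∀ a, coeff a f ≠ 0 → k ≤ wt C a := by
  rw [Polynomial.X_pow_dvd_iff]
  constructor
  · intro h a ha
    by_contra hk
    have := congrArg (coeff a) (h _ (not_le.1 hk))
    rw [wh_coeff, if_pos rfl, coeff_zero] at this
    exact ha this
  · intro h d hd
    ext a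
    rw [wh_coeff, coeff_zero]
    split_ifs with hw
    · by_contra h0
      have := h a h0
      omega
    · rfl

/-- The prime ideal generated by the variables in `C`. -/
def PC (K : Type) [Field K] {V : Type} (C : Set V) : Ideal (MvPolynomial V K) :=
  (Ideal.span {Polynomial.X}).comap (wh K C)

instance PC_prime (C : Set V) : (PC K C).IsPrime := by
  have : (Ideal.span {(Polynomial.X : Polynomial (MvPolynomial V K))}).IsPrime :=
    (Ideal.span_singleton_prime Polynomial.X_ne_zero).2 Polynomial.prime_X
  unfold PC
  infer_instance

theorem mem_PC_dvd {C : Set V} {f : MvPolynomial V K} :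
    f ∈ PC K C ↔ Polynomial.X ∣ wh K C f := by
  unfold PC
  rw [Ideal.mem_comap, Ideal.mem_span_singleton]

theorem mem_PC {C : Set V} {f : MvPolynomial V K} :
    f ∈ PC K C ↔ ∀ a, coeff a f ≠ 0 → 1 ≤ wt C a := by
  rw [mem_PC_dvd, ← wh_dvd, pow_one]

theorem X_mem_PC {C : Set V} {v : V} : (X v : MvPolynomial V K) ∈ PC K C ↔ v ∈ C := by
  rw [mem_PC]
  constructor
  · intro h
    have := h (Finsupp.single v 1) (by simp [coeff_X])
    rw [wt_single] at this
    by_contra hv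
    simp [hv] at this
  · intro hv a ha
    rw [coeff_X] at ha
    have : Finsupp.single v 1 = a := by by_contra h; simp [h] at ha
    rw [← this, wt_single, if_pos hv]

theorem PC_le {C : Set V} {p : Ideal (MvPolynomial V K)} (h : ∀ v ∈ C, X v ∈ p) : PC K C ≤ p := by
  intro f hf
  rw [mem_PC] at hf
  rw [f.as_sum]
  refine Ideal.sum_mem _ fun a ha => ?_
  obtain ⟨v, hv, hav⟩ := wt_pos (hf a (mem_support_iff.1 ha))
  have : Finsupp.single v 1 ≤ a := by
    rw [Finsupp.single_le_iff]; omega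
  obtain ⟨b, hb⟩ := exists_add_of_le this
  have e : monomial a (coeff a f) = X v * monomial b (coeff a f) := by
    rw [X, monomial_mul, one_mul, ← hb]
  rw [e]
  exact Ideal.mul_mem_right _ _ (h v hv)

/-- Vertex covers. -/
def cov (G : SimpleGraph V) : Set (Set V) := {C | ∀ u v, G.Adj u v → u ∈ C ∨ v ∈ C}

theorem edgeIdeal_le_PC {G : SimpleGraph V} {C : Set V} (hC : C ∈ cov G) :
    edgeIdeal K G ≤ PC K C := by
  unfold edgeIdeal
  rw [Ideal.span_le]
  rintro _ ⟨u, v, huv, rfl⟩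
  rcases hC u v huv with h | h
  · exact Ideal.mul_mem_right _ _ (X_mem_PC.2 h)
  · exact Ideal.mul_mem_left _ _ (X_mem_PC.2 h)

theorem edge_pow_dvd {G : SimpleGraph V} {C : Set V} (hC : C ∈ cov G) {s : ℕ}
    {f : MvPolynomial V K} (hf : f ∈ edgeIdeal K G ^ s) : Polynomial.X ^ s ∣ wh K C f := by
  have h1 := Ideal.pow_right_mono (edgeIdeal_le_PC (K := K) hC) s hf
  have h2 := Ideal.le_comap_pow (wh K C) s h1
  rw [Ideal.mem_comap, Ideal.span_singleton_pow, Ideal.mem_span_singleton] at h2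
  exact h2

/-- Exponents of the symbolic power. -/
def symE (G : SimpleGraph V) (s : ℕ) : Set (V →₀ ℕ) := {a | ∀ C ∈ cov G, s ≤ wt C a}

theorem symE_upper (G : SimpleGraph V) (s : ℕ) : IsUpperSet (symE G s) :=
  fun _ _ h ha C hC => (ha C hC).trans (wt_mono C h)

theorem minimal_prime {G : SimpleGraph V} {p : Ideal (MvPolynomial V K)}
    (hp : p ∈ (edgeIdeal K G).minimalPrimes) :
    {v | X v ∈ p} ∈ cov G ∧ p = PC K {v | X v ∈ p} := by
  have hprime : p.IsPrime := hp.1.1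
  have hc : {v | X v ∈ p} ∈ cov G := by
    intro u v huv
    exact hprime.mem_or_mem (hp.1.2 (Ideal.subset_span ⟨u, v, huv, rfl⟩))
  refine ⟨hc, ?_⟩
  have hle : PC K {v | X v ∈ p} ≤ p := PC_le fun v hv => hv
  exact le_antisymm (hp.2 ⟨PC_prime _, edgeIdeal_le_PC hc⟩ hle) hle

theorem symb_eq (G : SimpleGraph V) (s : ℕ) :
    symbolicPower (edgeIdeal K G) s = mI K (symE G s) := by
  apply le_antisymm
  · intro f hf
    rw [mem_mI' (symE_upper G s)]
    intro a ha C hC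
    obtain ⟨p, hp, hpC⟩ := Ideal.exists_minimalPrimes_le (edgeIdeal_le_PC (K := K) hC)
    obtain ⟨h1, h2⟩ := minimal_prime hp
    obtain ⟨t, ht, htf⟩ := hf p hp
    rw [h2, mem_PC_dvd] at ht
    have h3 := edge_pow_dvd h1 htf
    rw [map_mul] at h3
    have h4 := Polynomial.prime_X.pow_dvd_of_dvd_mul_left s ht h3
    refine (wh_dvd.1 h4 a ha).trans (wt_mono_set ?_ a)
    intro v hv
    exact X_mem_PC.1 (hpC hv)
  · unfold mI
    rw [Ideal.span_le]
    rintro _ ⟨a, ha, rfl⟩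
    intro p hp
    obtain ⟨h1, h2⟩ := minimal_prime hp
    have hprime : p.IsPrime := hp.1.1
    set C : Set V := {v | X v ∈ p} with hCdef
    have hnb : ∀ v ∈ C, ∃ u, G.Adj u v ∧ u ∉ C := by
      intro v hv
      by_contra hcon
      push Not at hcon
      have hc' : C \ {v} ∈ cov G := by
        intro x y hxy
        by_cases hx : x = v
        · subst hx
          right
          exact ⟨hcon y hxy.symm, fun h => hxy.ne (Set.mem_singleton_iff.1 h).symm⟩
        · by_cases hy : y = v
          · subst hy
            left
            exact ⟨hcon x hxy, hx⟩
          · rcases h1 x y hxy with h | h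
            · exact Or.inl ⟨h, hx⟩
            · exact Or.inr ⟨h, hy⟩
      have h3 : PC K (C \ {v}) ≤ p := PC_le fun w hw => hw.1
      have h4 := hp.2 ⟨PC_prime _, edgeIdeal_le_PC hc'⟩ h3 hv
      exact (X_mem_PC.1 h4).2 rfl
    have key : ∀ a : V →₀ ℕ, ∃ t, t ∉ p ∧
        t * (monomial a 1 : MvPolynomial V K) ∈ edgeIdeal K G ^ (wt C a) := by
      intro a
      have hone : (1 : MvPolynomial V K) ∉ p := (Ideal.ne_top_iff_one p).1 hprime.ne_top
      induction a using Finsupp.induction_linear with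
      | zero => exact ⟨1, hone, by simp⟩
      | add f g hf hg =>
        obtain ⟨t, ht, htf⟩ := hf
        obtain ⟨t', ht', htf'⟩ := hg
        refine ⟨t * t', fun h => (hprime.mem_or_mem h).elim ht ht', ?_⟩
        have e : t * t' * (monomial (f + g) 1 : MvPolynomial V K) =
            (t * monomial f 1) * (t' * monomial g 1) := by
          rw [mul_mul_mul_comm, monomial_mul, one_mul]
        rw [e, map_add, pow_add]
        exact Ideal.mul_mem_mul htf htf'
      | single v n =>
        rw [wt_single]
        split_ifs with hv
        · obtain ⟨u, huv, hu⟩ := hnb v hv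
          refine ⟨X u ^ n, fun h => hu (hprime.mem_of_pow_mem n h), ?_⟩
          rw [← X_pow_eq_monomial, ← mul_pow]
          have hm : (X u * X v : MvPolynomial V K) ∈ edgeIdeal K G :=
            Ideal.subset_span ⟨u, v, huv, rfl⟩
          exact Ideal.pow_mem_pow hm n
        · exact ⟨1, hone, by simp⟩
    obtain ⟨t, ht, hta⟩ := key a
    exact ⟨t, ht, Ideal.pow_le_pow_right (ha C h1) hta⟩

theorem univ_cov (G : SimpleGraph V) : Set.univ ∈ cov G := fun _ _ _ => Or.inl trivial

theorem symE_zero (G : SimpleGraph V) : symE G 0 = Set.univ :=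
  Set.eq_univ_of_forall fun _ _ _ => Nat.zero_le _

theorem symE_anti (G : SimpleGraph V) {s t : ℕ} (h : s ≤ t) : symE G t ⊆ symE G s :=
  fun _ ha C hC => h.trans (ha C hC)

theorem symb_ne_top (G : SimpleGraph V) {s : ℕ} (hs : 1 ≤ s) :
    symbolicPower (edgeIdeal K G) s ≠ ⊤ := by
  rw [symb_eq, Ideal.ne_top_iff_one]
  intro h
  have := (mem_mI' (symE_upper G s)).1 h 0 (by simp) Set.univ (univ_cov G)
  rw [map_zero] at this
  omega

variable {V₁ V₂ : Type}

theorem wt_sum (C : Set (V₁ ⊕ V₂)) (c : V₁ ⊕ V₂ →₀ ℕ) :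
    wt C c = wt (Sum.inl ⁻¹' C) (lp c) + wt (Sum.inr ⁻¹' C) (rp c) := by
  induction c using Finsupp.induction_linear with
  | zero =>
    have h1 : lp (0 : V₁ ⊕ V₂ →₀ ℕ) = 0 := by ext; rfl
    have h2 : rp (0 : V₁ ⊕ V₂ →₀ ℕ) = 0 := by ext; rfl
    simp [h1, h2]
  | add f g hf hg =>
    have h1 : lp (f + g) = lp f + lp g := by ext; rfl
    have h2 : rp (f + g) = rp f + rp g := by ext; rfl
    rw [h1, h2, map_add, map_add, map_add, hf, hg]
    omega
  | single v n =>
    rcases v with v | v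
    · rw [← Finsupp.sumElim_single_zero, lp_sumElim, rp_sumElim, Finsupp.sumElim_single_zero,
        wt_single, wt_single, map_zero, add_zero]
      rfl
    · rw [← Finsupp.sumElim_zero_single, lp_sumElim, rp_sumElim, Finsupp.sumElim_zero_single,
        wt_single, wt_single, map_zero, zero_add]
      rfl

theorem symE_sum (G₁ : SimpleGraph V₁) (G₂ : SimpleGraph V₂) (s : ℕ) (c : V₁ ⊕ V₂ →₀ ℕ) :
    c ∈ symE (G₁.sum G₂) s ↔ ∃ i ≤ s, c ∈ bx (symE G₁ i) (symE G₂ (s - i)) := by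
  constructor
  · intro h
    have hne : ∃ m, ∃ C ∈ cov G₁, wt C (lp c) = m := ⟨_, _, univ_cov G₁, rfl⟩
    obtain ⟨C, hC, hCm⟩ := Nat.find_spec hne
    have hmin : ∀ D ∈ cov G₁, Nat.find hne ≤ wt D (lp c) := fun D hD =>
      Nat.find_min' hne ⟨D, hD, rfl⟩
    set m := Nat.find hne
    refine ⟨min m s, min_le_right _ _, fun D hD => (min_le_left _ _).trans (hmin D hD), ?_⟩
    intro D hD
    have hcov : (Sum.inl '' C ∪ Sum.inr '' D) ∈ cov (G₁.sum G₂) := by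
      rintro (u | u) (v | v) huv
      · simpa using hC u v huv
      · simp at huv
      · simp at huv
      · simpa using hD u v huv
    have := h _ hcov
    rw [wt_sum] at this
    have e1 : (Sum.inl ⁻¹' (Sum.inl '' C ∪ Sum.inr '' D) : Set V₁) = C := by ext; simp
    have e2 : (Sum.inr ⁻¹' (Sum.inl '' C ∪ Sum.inr '' D) : Set V₂) = D := by ext; simp
    rw [e1, e2] at this
    omega
  · rintro ⟨i, hi, h1, h2⟩ C hC
    rw [wt_sum]
    have c1 : Sum.inl ⁻¹' C ∈ cov G₁ := fun u v huv => hC (Sum.inl u) (Sum.inl v) huv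
    have c2 : Sum.inr ⁻¹' C ∈ cov G₂ := fun u v huv => hC (Sum.inr u) (Sum.inr v) huv
    have := h1 _ c1
    have := h2 _ c2
    omega

end symb
end EdgeIdealReg

namespace EdgeIdealReg
open scoped Classical

section finiteness
variable {K : Type} [Field K] {V V₁ V₂ : Type}

/-- All edges live on a finite vertex set. -/
def FinE (G : SimpleGraph V) : Prop := ∃ W : Finset V, ∀ u v, G.Adj u v → u ∈ W ∧ v ∈ W

theorem FinE_left {G₁ : SimpleGraph V₁} {G₂ : SimpleGraph V₂} (h : FinE (G₁.sum G₂)) : FinE G₁ := by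
  obtain ⟨W, hW⟩ := h
  refine ⟨W.toLeft, fun u v huv => ?_⟩
  have := hW (Sum.inl u) (Sum.inl v) huv
  simpa using this

theorem FinE_right {G₁ : SimpleGraph V₁} {G₂ : SimpleGraph V₂} (h : FinE (G₁.sum G₂)) :
    FinE G₂ := by
  obtain ⟨W, hW⟩ := h
  refine ⟨W.toRight, fun u v huv => ?_⟩
  have := hW (Sum.inr u) (Sum.inr v) huv
  simpa using this

theorem FinE_of_fg {G : SimpleGraph V} {s : ℕ} (hs : 1 ≤ s) (h : (mI K (symE G s)).FG) :
    FinE G := by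
  unfold mI at h
  obtain ⟨T, hT, hTe⟩ := (Submodule.fg_span_iff_fg_span_finset_subset _).1 h
  obtain ⟨T', hT', rfl⟩ := Finset.subset_set_image_iff.1 hT
  refine ⟨T'.biUnion Finsupp.support, ?_⟩
  have key : ∀ u v, G.Adj u v → ∃ e ∈ T', e u ≠ 0 ∧ e v ≠ 0 := by
    intro u v huv
    let a : V →₀ ℕ := Finsupp.single u s + Finsupp.single v s
    have ha : a ∈ symE G s := by
      intro C hC
      have h1 : ∀ w ∈ C, (w = u ∨ w = v) → s ≤ wt C a := by
        intro w hw hwuv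
        refine le_trans ?_ (wt_ge (a := a) hw)
        rcases hwuv with rfl | rfl <;> simp [a]
      rcases hC u v huv with h | h
      · exact h1 u h (Or.inl rfl)
      · exact h1 v h (Or.inr rfl)
    have hm : (monomial a 1 : MvPolynomial V K) ∈ mI K (T' : Set (V →₀ ℕ)) := by
      have : (monomial a 1 : MvPolynomial V K) ∈ Submodule.span (MvPolynomial V K)
          ((fun s => monomial s (1 : K)) '' symE G s) := Submodule.subset_span ⟨a, ha, rfl⟩
      rw [hTe, Finset.coe_image] at this
      exact this
    obtain ⟨e, he, hea⟩ := monomial_mem_mI.1 hm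
    refine ⟨e, he, ?_⟩
    have h2 : ∀ x y, (∀ w, a w ≠ 0 → w = x ∨ w = y) → x ≠ y → e y ≠ 0 := by
      intro x y hxy hne
      have hc : ({x}ᶜ : Set V) ∈ cov G := by
        intro p q hpq
        by_contra hcon
        push Not at hcon
        simp only [Set.mem_compl_iff, Set.mem_singleton_iff, not_not] at hcon
        exact hpq.ne (hcon.1.trans hcon.2.symm)
      obtain ⟨w, hw, hew⟩ := wt_pos (hs.trans (hT' he _ hc))
      have haw : a w ≠ 0 := by
        have := hea w
        omega
      rcases hxy w haw with rfl | rfl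
      · exact absurd rfl hw
      · exact hew
    have h3 : ∀ w, a w ≠ 0 → w = u ∨ w = v := by
      intro w hw
      by_contra hcon
      push Not at hcon
      apply hw
      simp [a, hcon.1.symm, hcon.2.symm]
    exact ⟨h2 v u (fun w hw => (h3 w hw).symm) huv.ne.symm, h2 u v h3 huv.ne⟩
  intro u v huv
  obtain ⟨e, he, h1, h2⟩ := key u v huv
  simp only [Finset.mem_biUnion, Finsupp.mem_support_iff]
  exact ⟨⟨e, he, h1⟩, ⟨e, he, h2⟩⟩

theorem wt_le_of {C : Set V} {a b : V →₀ ℕ} (h : ∀ v ∈ C, a v ≤ b v) : wt C a ≤ wt C b := by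
  have h1 : wt C a = wt C (a.filter (· ∈ C)) := by
    conv_lhs => rw [← Finsupp.filter_add_filter_not a (· ∈ C), map_add]
    have : wt C (a.filter (fun v => ¬ v ∈ C)) = 0 := by
      by_contra h0
      obtain ⟨v, hv, hne⟩ := wt_pos (Nat.one_le_iff_ne_zero.2 h0)
      exact hne (Finsupp.filter_apply_neg _ _ (by simpa using hv))
    omega
  rw [h1]
  apply wt_mono
  intro v
  by_cases hv : v ∈ C
  · rw [Finsupp.filter_apply_pos _ _ hv]; exact h v hv
  · rw [Finsupp.filter_apply_neg _ _ hv]; exact Nat.zero_le _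

theorem exists_QI_symE {G : SimpleGraph V} (hG : FinE G) (s : ℕ) :
    ∃ d, ∀ n, QI n (mI K (symE G s)) d := by
  obtain ⟨W, hW⟩ := hG
  let M : V →₀ ℕ := Finsupp.indicator W (fun _ _ => s)
  have hM : ∀ v ∈ W, M v = s := fun v hv => Finsupp.indicator_of_mem hv _
  have hfin : ({a | a ∈ symE G s ∧ a ≤ M} : Set (V →₀ ℕ)).Finite :=
    (Set.finite_Iic M).subset fun a ha => ha.2
  have htr : ∀ a ∈ symE G s, a ⊓ M ∈ symE G s := by
    intro a ha C hC
    have hC' : C ∩ W ∈ cov G := by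
      intro u v huv
      obtain ⟨h1, h2⟩ := hW u v huv
      rcases hC u v huv with h | h
      · exact Or.inl ⟨h, h1⟩
      · exact Or.inr ⟨h, h2⟩
    refine le_trans ?_ (wt_mono_set (Set.inter_subset_left (t := (W : Set V))) _)
    by_cases hx : ∃ v ∈ C ∩ W, s ≤ a v
    · obtain ⟨v, hv, hsv⟩ := hx
      refine le_trans ?_ (wt_ge hv)
      rw [Finsupp.inf_apply, hM v hv.2]
      exact le_inf hsv le_rfl
    · push Not at hx
      refine (ha _ hC').trans (wt_le_of fun v hv => ?_)
      rw [Finsupp.inf_apply, hM v hv.2]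
      exact le_inf le_rfl (hx v hv).le
  have he : mI K (symE G s) = mI K (hfin.toFinset : Set (V →₀ ℕ)) := by
    ext f
    rw [mem_mI, mem_mI]
    refine forall_congr' fun a => imp_congr_right fun _ => ⟨?_, ?_⟩
    · rintro ⟨e, he, hea⟩
      exact ⟨e ⊓ M, by simpa using htr e he, inf_le_left.trans hea⟩
    · rintro ⟨e, he, hea⟩
      rw [Set.Finite.coe_toFinset] at he
      exact ⟨e, he.1, hea⟩
  rw [he]
  exact exists_QI _ _ le_rfl

end finiteness
end EdgeIdealReg

namespace EdgeIdealReg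
open scoped Classical

section transl
variable {K : Type} [Field K] {σ : Type}

local notation "𝕊" => MvPolynomial σ K

theorem homog_SG {f : 𝕊} {e : ℕ} (h : f.IsHomogeneous e) : f ∈ SG K σ e := by
  rw [mem_SG]
  intro a ha
  have := h ha
  rw [Finsupp.degree_eq_weight_one]
  exact_mod_cast this

theorem SG_homog {f : 𝕊} {e : ℕ} (h : f ∈ SG K σ e) : f.IsHomogeneous e := by
  rw [mem_SG] at h
  intro a ha
  have := h a ha
  rw [Finsupp.degree_eq_weight_one] at this
  exact_mod_cast this

theorem Q_of_eq (n : ℕ) {M : Type} [AddCommGroup M] [Module 𝕊 M] {𝓜 : ℤ → AddSubgroup M}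
    {d : ℤ} {N N' : Submodule 𝕊 M} (h : N = N')
    (hQ : Q (K := K) (σ := σ) n N (subG N 𝓜) d) : Q (K := K) (σ := σ) n N' (subG N' 𝓜) d := by
  subst h
  exact hQ

theorem Pres_mat {m m' : ℕ} (A : Matrix (Fin m) (Fin m') 𝕊) {deg : Fin m → ℕ} {deg' : Fin m' → ℕ}
    (hA : ∀ k l, A k l ∈ SG K σ ((deg' l : ℤ) - deg k)) :
    Pres (subG (LinearMap.range A.mulVecLin) (FG deg)) deg' A.mulVecLin.rangeRestrict := by
  refine ⟨LinearMap.surjective_rangeRestrict _, ?_, ?_⟩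
  · intro j x hx
    rw [mem_subG]
    change A.mulVecLin x ∈ _
    intro k
    change ∑ l, A k l * x l ∈ _
    refine sum_mem fun l _ => ?_
    have := SG_mul (hA k l) (hx l)
    have e : (deg' l : ℤ) - deg k + (j - deg' l) = j - deg k := by ring
    rwa [e] at this
  · rintro j ⟨_, x, rfl⟩ hm
    refine ⟨fun l => pr (j - deg' l) (x l), fun l => pr_mem _ _, ?_⟩
    ext1
    funext k
    have h1 : A.mulVecLin x k = ∑ l, A k l * x l := rfl
    have h2 : A.mulVecLin (fun l => pr (j - deg' l) (x l)) k =
        ∑ l, A k l * pr (j - deg' l) (x l) := rfl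
    have h3 := hm k
    have h4 := pr_of_mem h3
    change pr _ (A.mulVecLin x k) = A.mulVecLin x k at h4
    change A.mulVecLin (fun l => pr (j - deg' l) (x l)) k = A.mulVecLin x k
    rw [h2, ← h4, h1, pr_sum]
    refine Finset.sum_congr rfl fun l _ => ?_
    rw [pr_mul _ (hA k l)]
    congr 2
    ring

theorem res_mat {I : Ideal 𝕊} (F : GradedFreeResolution I) (i : ℕ) (k l) :
    F.mat i k l ∈ SG K σ ((F.deg (i + 1) l : ℤ) - F.deg i k) := by
  rcases F.homog i k l with h | ⟨e, he, hh⟩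
  · rw [h]; exact zero_mem _
  · have := homog_SG hh
    have e2 : (F.deg (i + 1) l : ℤ) - F.deg i k = e := by rw [he]; push_cast; ring
    rwa [e2]

theorem res_Q {I : Ideal 𝕊} (F : GradedFreeResolution I) {d : ℤ}
    (hd : ∀ i (k : Fin (F.rank i)), (F.deg i k : ℤ) ≤ d + i) (n : ℕ) : ∀ i : ℕ,
    Q (K := K) (σ := σ) n (LinearMap.range (F.mat i).mulVecLin)
      (subG (LinearMap.range (F.mat i).mulVecLin) (FG (F.deg i))) (d + i + 1) := by
  induction n with
  | zero => intro i; trivial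
  | succ n ih =>
    intro i
    refine ⟨_, inferInstance, F.deg (i + 1), (F.mat i).mulVecLin.rangeRestrict, ?_,
      Pres_mat _ (res_mat F i), ?_⟩
    · intro k
      have := hd (i + 1) k
      push_cast at this
      linarith
    · have h := ih (i + 1)
      have e : (d + ((i + 1 : ℕ) : ℤ) + 1) = d + i + 1 + 1 := by push_cast; ring
      rw [e] at h
      refine Q_of_eq n ?_ h
      rw [LinearMap.ker_rangeRestrict, F.isExact]

theorem res_QI {I : Ideal 𝕊} (F : GradedFreeResolution I) {d : ℤ}
    (hd : ∀ i (k : Fin (F.rank i)), (F.deg i k : ℤ) ≤ d + i) (n : ℕ) : QI n I (d + 1) := by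
  have h := res_Q F hd n 0
  have e : d + ((0 : ℕ) : ℤ) + 1 = d + 1 := by simp
  rw [e] at h
  let g : I →ₗ[𝕊] LinearMap.range (F.mat 0).mulVecLin :=
    { toFun := fun f => ⟨fun _ => f, (F.range_zero _).1 f.2⟩
      map_add' := fun _ _ => rfl
      map_smul' := fun _ _ => rfl }
  have k0 : Fin (F.rank 0) := ⟨0, by rw [F.rank_zero]; exact one_pos⟩
  have hsub : Subsingleton (Fin (F.rank 0)) := by rw [F.rank_zero]; infer_instance
  have hg : Function.Bijective g := by
    constructor
    · intro x y hxy
      ext1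
      exact congrFun (congrArg Subtype.val hxy) k0
    · rintro ⟨x, hx⟩
      have hxe : x = fun _ => x k0 := by
        funext k
        rw [Subsingleton.elim k k0]
      refine ⟨⟨x k0, (F.range_zero _).2 (by rw [← hxe]; exact hx)⟩, ?_⟩
      ext1
      exact hxe.symm
  refine Q_iso n (LinearEquiv.ofBijective g hg).symm ?_ h
  intro j m
  obtain ⟨x, rfl⟩ := hg.2 m
  have : (LinearEquiv.ofBijective g hg).symm (g x) = x :=
    (LinearEquiv.ofBijective g hg).symm_apply_apply x
  rw [this, mem_subG, mem_subG]
  constructor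
  · intro hx k
    rw [F.deg_zero, Nat.cast_zero, sub_zero]
    exact hx
  · intro hx
    have := hx k0
    rw [F.deg_zero, Nat.cast_zero, sub_zero] at this
    exact this

/-- State of the construction of a resolution. -/
structure St (K : Type) [Field K] (σ : Type) where
  m : ℕ
  deg : Fin m → ℕ
  N : Submodule (MvPolynomial σ K) (Fin m → MvPolynomial σ K)
  d : ℤ
  hQ : ∀ n, Q (K := K) (σ := σ) n N (subG N (FG deg)) d

/-- Size of the next step. -/
def St.m' (s : St K σ) : ℕ := (Q_step s.hQ).choose
def St.deg' (s : St K σ) : Fin s.m' → ℕ := (Q_step s.hQ).choose_spec.choose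
def St.φ (s : St K σ) : (Fin s.m' → 𝕊) →ₗ[𝕊] s.N := (Q_step s.hQ).choose_spec.choose_spec.choose
theorem St.spec (s : St K σ) : Pres (subG s.N (FG s.deg)) s.deg' s.φ ∧
      (∀ k, (s.deg' k : ℤ) ≤ s.d) ∧
      ∀ n, Q (K := K) (σ := σ) n (LinearMap.ker s.φ) (subG (LinearMap.ker s.φ) (FG s.deg')) (s.d + 1) :=
  (Q_step s.hQ).choose_spec.choose_spec.choose_spec

/-- Next state. -/
def St.next (s : St K σ) : St K σ := ⟨s.m', s.deg', LinearMap.ker s.φ, s.d + 1, s.spec.2.2⟩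

/-- The matrix of the differential. -/
def St.mat (s : St K σ) : Matrix (Fin s.m) (Fin s.m') 𝕊 :=
  LinearMap.toMatrix' (s.N.subtype ∘ₗ s.φ)

theorem St.mat_lin (s : St K σ) : s.mat.mulVecLin = s.N.subtype ∘ₗ s.φ := by
  rw [← Matrix.toLin'_apply']
  exact LinearMap.toMatrix'.symm_apply_apply _

theorem St.mat_ker (s : St K σ) : LinearMap.ker s.mat.mulVecLin = LinearMap.ker s.φ := by
  rw [s.mat_lin, LinearMap.ker_comp, Submodule.ker_subtype, Submodule.comap_bot]

theorem St.mat_range (s : St K σ) : LinearMap.range s.mat.mulVecLin = s.N := by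
  rw [s.mat_lin, LinearMap.range_comp, LinearMap.range_eq_top.2 s.spec.1.surj,
    Submodule.map_top, Submodule.range_subtype]

theorem St.mat_homog (s : St K σ) (k l) : s.mat k l = 0 ∨
    ∃ e, s.deg' l = s.deg k + e ∧ (s.mat k l).IsHomogeneous e := by
  by_cases h0 : s.mat k l = 0
  · exact Or.inl h0
  · right
    have h1 : s.mat k l ∈ SG K σ ((s.deg' l : ℤ) - s.deg k) := by
      have h2 := s.spec.1.gr _ _ (single_mem_FG (K := K) (σ := σ) s.deg' l) k
      have h3 : s.mat k l = (s.φ (Pi.single l 1) : Fin s.m → 𝕊) k := by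
        unfold St.mat
        rw [LinearMap.toMatrix'_apply]
        rfl
      rw [h3]
      convert h2
      change _ = ((s.φ _ : s.N) : Fin s.m → 𝕊) k
      congr!
    obtain ⟨a, ha⟩ := MvPolynomial.ne_zero_iff.1 h0
    have h2 := mem_SG.1 h1 a ha
    refine ⟨a.degree, by omega, SG_homog ?_⟩
    rwa [h2]

/-- The sequence of states. -/
def stSeq (s : St K σ) : ℕ → St K σ
  | 0 => s
  | i + 1 => (stSeq s i).next

theorem stSeq_d (s : St K σ) (i : ℕ) : (stSeq s i).d = s.d + i := by
  induction i with
  | zero => simp [stSeq]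
  | succ i ih =>
    change (stSeq s i).d + 1 = _
    rw [ih]; push_cast; ring

theorem exists_res {I : Ideal 𝕊} {d : ℤ} (hd : 0 ≤ d) (h : ∀ n, QI n I (d + 1)) :
    ∃ F : GradedFreeResolution I, ∀ i (k : Fin (F.rank i)), (F.deg i k : ℤ) ≤ d + i := by
  let N : Submodule 𝕊 (Fin 1 → 𝕊) := Submodule.comap (LinearMap.proj 0) I
  have hN : ∀ x, x ∈ N ↔ x 0 ∈ I := fun x => Iff.rfl
  let g : I →ₗ[𝕊] N :=
    { toFun := fun f => ⟨fun _ => f, f.2⟩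
      map_add' := fun _ _ => rfl
      map_smul' := fun _ _ => rfl }
  have hg : Function.Bijective g := by
    constructor
    · intro x y hxy
      ext1
      exact congrFun (congrArg Subtype.val hxy) 0
    · rintro ⟨x, hx⟩
      refine ⟨⟨x 0, hx⟩, ?_⟩
      ext1
      funext k
      rw [Subsingleton.elim k 0]
      rfl
  have hQ : ∀ n, Q (K := K) (σ := σ) n N (subG N (FG (fun _ => 0))) (d + 1) := by
    intro n
    refine Q_iso n (LinearEquiv.ofBijective g hg) ?_ (h n)
    intro j m
    rw [LinearEquiv.ofBijective_apply, mem_subG, mem_subG]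
    constructor
    · intro hx
      have := hx 0
      rw [Nat.cast_zero, sub_zero] at this
      exact this
    · intro hx k
      rw [Nat.cast_zero, sub_zero]
      exact hx
  let s : St K σ := ⟨1, fun _ => 0, N, d + 1, hQ⟩
  refine ⟨⟨fun i => (stSeq s i).m, fun i => (stSeq s i).deg, rfl, fun k => rfl,
    fun i => (stSeq s i).mat, fun i => (stSeq s i).mat_homog, ?_, ?_⟩, ?_⟩
  · intro f
    have := (stSeq s 0).mat_range
    change f ∈ I ↔ (fun x => f) ∈ LinearMap.range (St.mat (stSeq s 0)).mulVecLin
    rw [this]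
    exact Iff.rfl
  · intro i
    exact (stSeq s i).mat_ker.trans (stSeq s (i + 1)).mat_range.symm
  · intro i k
    cases i with
    | zero =>
      change ((0 : ℕ) : ℤ) ≤ _
      push_cast; omega
    | succ i =>
      have := (stSeq s i).spec.2.1 k
      rw [stSeq_d] at this
      change _ ≤ d + 1 + (i : ℤ) at this
      change (((stSeq s i).deg' k : ℕ) : ℤ) ≤ _
      push_cast
      linarith

/-- The set whose infimum is the regularity. -/
def regSet (I : Ideal 𝕊) : Set ℤ := { d : ℤ | ∃ F : GradedFreeResolution I,
      ∀ i (k : Fin (F.rank i)), (F.deg i k : ℤ) ≤ d + i }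

theorem regQuot_eq {I : Ideal 𝕊} (hI : I ≠ ⊤) : regQuot I = ((sInf (regSet I) : ℤ) : WithBot ℤ) := by
  unfold regQuot
  rw [if_neg hI]
  rfl

theorem regSet_nonneg {I : Ideal 𝕊} : ∀ d ∈ regSet I, 0 ≤ d := by
  rintro d ⟨F, hF⟩
  have := hF 0 ⟨0, by rw [F.rank_zero]; exact one_pos⟩
  rw [F.deg_zero] at this
  simpa using this

theorem regQuot_nonneg {I : Ideal 𝕊} (hI : I ≠ ⊤) {x : ℤ} (h : regQuot I ≤ (x : WithBot ℤ)) :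
    0 ≤ x := by
  rw [regQuot_eq hI, WithBot.coe_le_coe] at h
  refine le_trans ?_ h
  rcases (regSet I).eq_empty_or_nonempty with he | hne
  · rw [he, Int.csInf_empty]
  · exact le_csInf hne regSet_nonneg

theorem QI_of_reg {I : Ideal 𝕊} (hI : I ≠ ⊤) {x : ℤ} (h : regQuot I ≤ (x : WithBot ℤ))
    (hne : (regSet I).Nonempty) (n : ℕ) : QI n I (x + 1) := by
  rw [regQuot_eq hI, WithBot.coe_le_coe] at h
  obtain ⟨F, hF⟩ := Int.csInf_mem hne ⟨0, regSet_nonneg⟩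
  exact Q_mono n (by linarith) (res_QI F hF n)

theorem reg_of_QI {I : Ideal 𝕊} {x : ℤ} (hx : 0 ≤ x) (h : ∀ n, QI n I (x + 1)) :
    regQuot I ≤ (x : WithBot ℤ) := by
  by_cases hI : I = ⊤
  · unfold regQuot
    rw [if_pos hI]
    exact bot_le
  · rw [regQuot_eq hI, WithBot.coe_le_coe]
    exact csInf_le ⟨0, regSet_nonneg⟩ (exists_res hx h)

theorem regSet_nonempty {I : Ideal 𝕊} {x : ℤ} (h : ∀ n, QI n I x) : (regSet I).Nonempty :=
  ⟨max x 0, exists_res (le_max_right _ _) fun n =>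
    Q_mono n (by have := le_max_left x 0; omega) (h n)⟩

theorem regSet_fg {I : Ideal 𝕊} (h : (regSet I).Nonempty) : I.FG := by
  obtain ⟨d, F, hF⟩ := h
  obtain ⟨ι, hι, deg, φ, h1, h2, -⟩ := res_QI F hF 1
  have : Module.Finite 𝕊 I := Module.Finite.of_surjective φ h2.surj
  exact Module.Finite.iff_fg.1 this

end transl
end EdgeIdealReg

namespace EdgeIdealReg
open scoped Classical

section final
variable {K : Type} [Field K] {V₁ V₂ : Type}

/-- The partial unions of products of symbolic powers. -/
def PU (G₁ : SimpleGraph V₁) (G₂ : SimpleGraph V₂) (s k : ℕ) : Set (V₁ ⊕ V₂ →₀ ℕ) :=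
  {c | ∃ i, k ≤ i ∧ i ≤ s ∧ c ∈ bx (symE G₁ i) (symE G₂ (s - i))}

theorem PU_upper (G₁ : SimpleGraph V₁) (G₂ : SimpleGraph V₂) (s k : ℕ) :
    IsUpperSet (PU G₁ G₂ s k) := by
  rintro a b hab ⟨i, h1, h2, h3⟩
  exact ⟨i, h1, h2, bx_upper (symE_upper _ _) (symE_upper _ _) hab h3⟩

theorem PU_QI {G₁ : SimpleGraph V₁} {G₂ : SimpleGraph V₂} {s : ℕ} {D : ℤ}
    (h1 : ∀ k ≤ s, ∀ n, QI n (mI K (bx (symE G₁ k) (symE G₂ (s - k)))) D)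
    (h2 : ∀ k < s, ∀ n, QI n (mI K (bx (symE G₁ (k + 1)) (symE G₂ (s - k)))) (D + 1))
    (j : ℕ) (hj : j ≤ s) : ∀ n, QI n (mI K (PU G₁ G₂ s (s - j))) D := by
  induction j with
  | zero =>
    intro n
    have e : PU G₁ G₂ s (s - 0) = bx (symE G₁ s) (symE G₂ (s - s)) := by
      ext c
      constructor
      · rintro ⟨i, hi, hi', hc⟩
        have : i = s := by omega
        rwa [this] at hc
      · intro hc
        exact ⟨s, by omega, le_rfl, hc⟩
    rw [e]
    exact h1 s le_rfl n
  | succ j ih =>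
    intro n
    obtain ⟨k, hk⟩ : ∃ k, k = s - (j + 1) := ⟨_, rfl⟩
    have hk' : s - j = k + 1 := by omega
    have hks : k < s := by omega
    rw [← hk]
    have ih' := ih (by omega)
    rw [hk'] at ih'
    have e : PU G₁ G₂ s k = PU G₁ G₂ s (k + 1) ∪ bx (symE G₁ k) (symE G₂ (s - k)) := by
      ext c
      constructor
      · rintro ⟨i, hi, hi', hc⟩
        by_cases hik : i = k
        · right; rwa [hik] at hc
        · left; exact ⟨i, by omega, hi', hc⟩
      · rintro (⟨i, hi, hi', hc⟩ | hc)
        · exact ⟨i, by omega, hi', hc⟩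
        · exact ⟨k, le_rfl, hks.le, hc⟩
    have e2 : PU G₁ G₂ s (k + 1) ∩ bx (symE G₁ k) (symE G₂ (s - k)) =
        bx (symE G₁ (k + 1)) (symE G₂ (s - k)) := by
      ext c
      constructor
      · rintro ⟨⟨i, hi, hi', hc⟩, hc'⟩
        exact ⟨symE_anti G₁ hi hc.1, hc'.2⟩
      · intro hc
        exact ⟨⟨k + 1, le_rfl, hks, hc.1, symE_anti G₂ (by omega) hc.2⟩,
          symE_anti G₁ (by omega) hc.1, hc.2⟩
    rw [e, ← mI_sup]
    refine QI_mv n (pr_mI _) (pr_mI _) (ih' n) (h1 k hks.le n) ?_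
    rw [mI_inf (PU_upper _ _ _ _) (bx_upper (symE_upper _ _) (symE_upper _ _)), e2]
    exact h2 k hks n

theorem QI_symE {V : Type} {G : SimpleGraph V} {r : ℕ} {ρ : ℤ} (hr : 1 ≤ r)
    (h : ∀ s : ℕ, 1 ≤ s → s ≤ r →
      regQuot (symbolicPower (edgeIdeal K G) s) ≤ ((2 * (s : ℤ) + ρ - 2 : ℤ) : WithBot ℤ))
    (hG : FinE G) (k : ℕ) (hk : k ≤ r) (n : ℕ) :
    QI n (mI K (symE G k)) (if k = 0 then 0 else 2 * (k : ℤ) + ρ - 1) := by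
  split_ifs with h0
  · subst h0
    rw [symE_zero]
    exact mI_univ_QI n (Set.mem_univ _)
  · have hk1 : 1 ≤ k := Nat.one_le_iff_ne_zero.2 h0
    obtain ⟨d, hd⟩ := exists_QI_symE (K := K) hG k
    rw [← symb_eq] at hd
    have := QI_of_reg (symb_ne_top G hk1) (h k hk1 hk) (regSet_nonempty hd) n
    rw [symb_eq] at this
    exact Q_mono n (by linarith) this

theorem rho_nonneg {V : Type} {G : SimpleGraph V} {r : ℕ} {ρ : ℤ} (hr : 1 ≤ r)
    (h : ∀ s : ℕ, 1 ≤ s → s ≤ r →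
      regQuot (symbolicPower (edgeIdeal K G) s) ≤ ((2 * (s : ℤ) + ρ - 2 : ℤ) : WithBot ℤ)) :
    0 ≤ ρ := by
  have := regQuot_nonneg (symb_ne_top G le_rfl) (h 1 le_rfl hr)
  push_cast at this
  linarith

end final
end EdgeIdealReg

open EdgeIdealReg in
/-- If `reg(S/I(G_i)^{(s)}) ≤ 2s + ρ_i - 2` for `1 ≤ s ≤ r` and `i = 1, 2`, then for the
disjoint union `G = G₁ ⊔ G₂` one has `reg(S/I(G)^{(s)}) ≤ 2s + ρ₁ + ρ₂ - 2` for `1 ≤ s ≤ r`. -/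
theorem reg_symbolic_disjoint_union_bound {V₁ V₂ K : Type} [Field K]
    (G₁ : SimpleGraph V₁) (G₂ : SimpleGraph V₂) (r : ℕ) (hr : 1 ≤ r) (ρ₁ ρ₂ : ℤ)
    (h₁ : ∀ s : ℕ, 1 ≤ s → s ≤ r →
      regQuot (symbolicPower (edgeIdeal K G₁) s) ≤ ((2 * (s : ℤ) + ρ₁ - 2 : ℤ) : WithBot ℤ))
    (h₂ : ∀ s : ℕ, 1 ≤ s → s ≤ r →
      regQuot (symbolicPower (edgeIdeal K G₂) s) ≤ ((2 * (s : ℤ) + ρ₂ - 2 : ℤ) : WithBot ℤ)) :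
    ∀ s : ℕ, 1 ≤ s → s ≤ r →
      regQuot (symbolicPower (edgeIdeal K (G₁.sum G₂)) s) ≤
        ((2 * (s : ℤ) + ρ₁ + ρ₂ - 2 : ℤ) : WithBot ℤ) := by
  intro s hs hsr
  have r1 := rho_nonneg hr h₁
  have r2 := rho_nonneg hr h₂
  have hx : (0 : ℤ) ≤ 2 * (s : ℤ) + ρ₁ + ρ₂ - 2 := by
    have : (1 : ℤ) ≤ s := by exact_mod_cast hs
    linarith
  rcases (regSet (symbolicPower (edgeIdeal K (G₁.sum G₂)) s)).eq_empty_or_nonempty with he | hne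
  · rw [regQuot_eq (symb_ne_top _ hs), he, Int.csInf_empty]
    exact WithBot.coe_le_coe.2 hx
  · have hfg := regSet_fg hne
    rw [symb_eq] at hfg
    have hF := FinE_of_fg hs hfg
    have q1 := QI_symE hr h₁ (FinE_left hF)
    have q2 := QI_symE hr h₂ (FinE_right hF)
    apply reg_of_QI hx
    have key := PU_QI (K := K) (G₁ := G₁) (G₂ := G₂) (s := s)
      (D := 2 * (s : ℤ) + ρ₁ + ρ₂ - 2 + 1) ?_ ?_ s le_rfl
    · have e : PU G₁ G₂ s (s - s) = symE (G₁.sum G₂) s := by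
        ext c
        rw [symE_sum]
        constructor
        · rintro ⟨i, -, h⟩
          exact ⟨i, h⟩
        · rintro ⟨i, h⟩
          exact ⟨i, by omega, h⟩
      rw [e, ← symb_eq] at key
      exact key
    · intro k hk n
      have := bx_QI (symE_upper G₁ k) (symE_upper G₂ (s - k)) (q1 k (by omega))
        (q2 (s - k) (by omega)) n
      refine Q_mono n ?_ this
      have hc : ((s - k : ℕ) : ℤ) = s - k := by push_cast [hk]; ring
      split_ifs <;> omega
    · intro k hk n
      have := bx_QI (symE_upper G₁ (k + 1)) (symE_upper G₂ (s - k)) (q1 (k + 1) (by omega))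
        (q2 (s - k) (by omega)) n
      refine Q_mono n ?_ this
      have hc : ((s - k : ℕ) : ℤ) = s - k := by push_cast [hk.le]; ring
      split_ifs <;> omega
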